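/- (i) For every lambda ∈ (0,∞) there exist constants alpha_lambda^+, alpha_lambda^− ∈ (0,∞) such that if (k_N) are positive integers and (G_N) finite Abelian groups with k_N → ∞, k_N/log|G_N| → lambda, m_*(G_N) → ∞ and d(G_N) ≤ (1/4)·log|G_N|/log log|G_N| for every N, then both: for every beta ∈ (0,1), D_N^±(beta)/(alpha_lambda^±·k_N) → 1 in probability, and diam G_N^±(Z)/(alpha_lambda^±·k_N) → 1 in probability as N → ∞. (ii) If k_N/log|G_N| → ∞ and log k_N/log|G_N| → 0, then with rho_N := log k_N/log log|G_N|, diam G_N^±(Z)/((rho_N/(rho_N − 1))·log|G_N|/log k_N) → 1 in probability as N → ∞ for finite Abelian (G_N). In both regimes the lower bound on the diameter holds deterministically (for every choice of generator tuples) for all Abelian groups, and in regime (ii) the upper bound holds for arbitrary finite groups. -/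

import Mathlib

open Filter

/-- Number of elements of `G` reachable from the identity by a word of length at most `r`
in the generators `z` (undirected case: inverses allowed; directed case `undir = false`:
only positive letters). -/
noncomputable def cayBallCard {G : Type*} [Group G] (undir : Bool) {k : ℕ}
    (z : Fin k → G) (r : ℕ) : ℕ :=
  Nat.card {x : G // ∃ n : ℕ, n ≤ r ∧ ∃ w : Fin n → Fin k × Bool,
    (undir = false → ∀ i, (w i).2 = true) ∧
    x = (List.ofFn fun i => if (w i).2 then z (w i).1 else (z (w i).1)⁻¹).prod}

/-- The `β`-typical distance of the Cayley graph of `G` with generators `z`. -/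
noncomputable def typDist {G : Type*} [Group G] [Fintype G] (undir : Bool) {k : ℕ}
    (z : Fin k → G) (β : ℝ) : ℕ :=
  sInf {r : ℕ | β * (Fintype.card G : ℝ) ≤ (cayBallCard undir z r : ℝ)}

/-- Graph distance from `x` to `y` in the Cayley graph of `G` with generators `z`
(`⊤` if `y` is not reachable from `x`). -/
noncomputable def cayDist {G : Type*} [Group G] (undir : Bool) {k : ℕ}
    (z : Fin k → G) (x y : G) : ℕ∞ :=
  sInf {ℓ : ℕ∞ | ∃ n : ℕ, ℓ = (n : ℕ∞) ∧ ∃ w : Fin n → Fin k × Bool,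
    (undir = false → ∀ i, (w i).2 = true) ∧
    y = x * (List.ofFn fun i => if (w i).2 then z (w i).1 else (z (w i).1)⁻¹).prod}

/-- Diameter of the Cayley graph of `G` with generators `z`
(`⊤` if not (strongly) connected). -/
noncomputable def cayDiam {G : Type*} [Group G] (undir : Bool) {k : ℕ}
    (z : Fin k → G) : ℕ∞ :=
  ⨆ x : G, ⨆ y : G, cayDist undir z x y

/-- Probability, over a uniformly random `k`-tuple of elements of `G`, of the event `p`. -/
noncomputable def tupleProb (G : Type*) [Fintype G] (k : ℕ) (p : (Fin k → G) → Prop) : ℝ :=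
  (Nat.card {z : Fin k → G // p z} : ℝ) / (Fintype.card G : ℝ) ^ k

/-- Minimal size of a generating subset of `G`. -/
noncomputable def minGen (G : Type*) [Group G] : ℕ :=
  sInf {n : ℕ | ∃ s : Finset G, s.card = n ∧ Subgroup.closure (s : Set G) = ⊤}

/-- `m_*(G)`: the maximum, over all decompositions of `G` as a direct sum of cyclic
groups `Z_{m_1} ⊕ ... ⊕ Z_{m_d}`, of `min_j m_j`. -/
noncomputable def mStar (G : Type*) [CommGroup G] : ℕ :=
  sSup {t : ℕ | ∃ (d : ℕ) (m : Fin d → ℕ),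
    Nonempty (G ≃* ∀ j : Fin d, Multiplicative (ZMod (m j))) ∧ ∀ j, t ≤ m j}

/-- The candidate typical distance `(ρ/(ρ−1))·log n/log k`, where `ρ := log k/log log n`. -/
noncomputable def typDistTargetLarge (k n : ℕ) : ℝ :=
  (Real.log k / Real.log (Real.log n)) / (Real.log k / Real.log (Real.log n) - 1) *
    (Real.log n / Real.log k)

section RandomCayleyGraphs

open Finset

section Words

variable {G : Type*} [Group G] {k : ℕ}

/-- The group element denoted by a signed generator. -/
def letterVal (z : Fin k → G) (a : Fin k × Bool) : G :=
  if a.2 then z a.1 else (z a.1)⁻¹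

/-- `x` is the value of a word of length at most `r` in the generators `z`. -/
def Reach (undir : Bool) (z : Fin k → G) (r : ℕ) (x : G) : Prop :=
  ∃ l : List (Fin k × Bool), l.length ≤ r ∧ (undir = false → ∀ a ∈ l, a.2 = true) ∧
    x = (l.map (letterVal z)).prod

theorem reach_iff_ofFn {undir : Bool} {z : Fin k → G} {r : ℕ} {x : G} :
    Reach undir z r x ↔ ∃ n : ℕ, n ≤ r ∧ ∃ w : Fin n → Fin k × Bool,
      (undir = false → ∀ i, (w i).2 = true) ∧
      x = (List.ofFn fun i => if (w i).2 then z (w i).1 else (z (w i).1)⁻¹).prod := by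
  constructor
  · rintro ⟨l, hl, hu, rfl⟩
    refine ⟨l.length, hl, l.get, fun h i => hu h _ (List.get_mem _ _), ?_⟩
    congr 1
    conv_lhs => rw [← List.ofFn_get l, List.map_ofFn]
    rfl
  · rintro ⟨n, hn, w, hu, rfl⟩
    refine ⟨List.ofFn w, by simpa using hn, fun h a ha => ?_, ?_⟩
    · obtain ⟨i, rfl⟩ := (List.mem_ofFn' _ _).1 ha
      exact hu h i
    · rw [List.map_ofFn]; rfl

theorem cayBallCard_eq (undir : Bool) (z : Fin k → G) (r : ℕ) :
    cayBallCard undir z r = Nat.card {x : G // Reach undir z r x} := by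
  simp only [cayBallCard, reach_iff_ofFn]

theorem Reach.mono {undir : Bool} {z : Fin k → G} {r s : ℕ} {x : G}
    (h : Reach undir z r x) (hrs : r ≤ s) : Reach undir z s x := by
  obtain ⟨l, hl, hu, hx⟩ := h
  exact ⟨l, hl.trans hrs, hu, hx⟩

theorem Reach.mul {undir : Bool} {z : Fin k → G} {r s : ℕ} {x y : G}
    (hx : Reach undir z r x) (hy : Reach undir z s y) : Reach undir z (r + s) (x * y) := by
  obtain ⟨l, hl, hu, rfl⟩ := hx
  obtain ⟨l', hl', hu', rfl⟩ := hy
  refine ⟨l ++ l', by simp; lia, fun h a ha => ?_, by simp⟩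
  rcases List.mem_append.1 ha with ha | ha
  exacts [hu h a ha, hu' h a ha]

theorem reach_one (undir : Bool) (z : Fin k → G) : Reach undir z 0 1 :=
  ⟨[], by simp, by simp, by simp⟩

theorem reach_generator (undir : Bool) (z : Fin k → G) (i : Fin k) : Reach undir z 1 (z i) :=
  ⟨[(i, true)], by simp, by simp, by simp [letterVal]⟩

theorem reach_generator_inv (z : Fin k → G) (i : Fin k) : Reach true z 1 (z i)⁻¹ :=
  ⟨[(i, false)], by simp, by simp, by simp [letterVal]⟩

theorem Reach.pow {undir : Bool} {z : Fin k → G} {r : ℕ} {x : G}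
    (hx : Reach undir z r x) (n : ℕ) : Reach undir z (n * r) (x ^ n) := by
  induction n with
  | zero => simpa using reach_one undir z
  | succ n ih =>
    rw [pow_succ, Nat.succ_mul]
    exact ih.mul hx

theorem reach_zpow {undir : Bool} (z : Fin k → G) (i : Fin k) (v : ℤ)
    (hv : undir = false → 0 ≤ v) : Reach undir z v.natAbs (z i ^ v) := by
  rcases le_or_gt 0 v with h | h
  · lift v to ℕ using h
    simpa using (reach_generator undir z i).pow v
  · cases undir
    · exact absurd (hv rfl) (by lia)
    · have := (reach_generator_inv z i).pow v.natAbs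
      rw [mul_one, inv_pow, ← zpow_natCast, ← zpow_neg] at this
      convert this using 2
      lia

theorem Reach.comp {m : ℕ} {undir : Bool} {z : Fin k → G} {r : ℕ} {x : G} (f : Fin m → Fin k)
    (h : Reach undir (fun i => z (f i)) r x) : Reach undir z r x := by
  obtain ⟨l, hl, hu, rfl⟩ := h
  refine ⟨l.map (Prod.map f id), by simpa using hl, fun h a ha => ?_, ?_⟩
  · obtain ⟨b, hb, rfl⟩ := List.mem_map.1 ha
    exact hu h b hb
  · rw [List.map_map]; rfl

theorem reach_ofFn_prod (undir : Bool) (z : Fin k → G) {n : ℕ} (f : Fin n → Fin k) :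
    Reach undir z n (List.ofFn fun j => z (f j)).prod := by
  refine ⟨List.ofFn fun j => (f j, true), by simp, fun _ a ha => ?_, ?_⟩
  · obtain ⟨i, rfl⟩ := (List.mem_ofFn' _ _).1 ha
    rfl
  · rw [List.map_ofFn]; rfl

theorem cayDist_le_iff {undir : Bool} {z : Fin k → G} {r : ℕ} {x y : G} :
    cayDist undir z x y ≤ r ↔ Reach undir z r (x⁻¹ * y) := by
  have key : ∀ n : ℕ, (∃ w : Fin n → Fin k × Bool, (undir = false → ∀ i, (w i).2 = true) ∧
      y = x * (List.ofFn fun i => if (w i).2 then z (w i).1 else (z (w i).1)⁻¹).prod) ↔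
      (∃ w : Fin n → Fin k × Bool, (undir = false → ∀ i, (w i).2 = true) ∧
      x⁻¹ * y = (List.ofFn fun i => if (w i).2 then z (w i).1 else (z (w i).1)⁻¹).prod) := by
    intro n
    simp only [inv_mul_eq_iff_eq_mul]
  constructor
  · intro h
    set A : Set ℕ∞ := {ℓ : ℕ∞ | ∃ n : ℕ, ℓ = (n : ℕ∞) ∧ ∃ w : Fin n → Fin k × Bool,
      (undir = false → ∀ i, (w i).2 = true) ∧
      y = x * (List.ofFn fun i => if (w i).2 then z (w i).1 else (z (w i).1)⁻¹).prod} with hA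
    have hne : A.Nonempty := by
      by_contra hne
      rw [Set.not_nonempty_iff_eq_empty] at hne
      have : cayDist undir z x y = sInf A := rfl
      rw [this, hne, sInf_empty] at h
      simp at h
    obtain ⟨n, hn, hw⟩ := csInf_mem hne
    have : cayDist undir z x y = n := hn
    rw [this] at h
    exact reach_iff_ofFn.2 ⟨n, by exact_mod_cast h, (key n).1 hw⟩
  · intro h
    obtain ⟨n, hn, hw⟩ := reach_iff_ofFn.1 h
    have : cayDist undir z x y ≤ n := sInf_le ⟨n, rfl, (key n).2 hw⟩
    exact this.trans (by exact_mod_cast hn)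

theorem cayDiam_le_iff {undir : Bool} {z : Fin k → G} {r : ℕ} :
    cayDiam undir z ≤ r ↔ ∀ x, Reach undir z r x := by
  simp only [cayDiam, iSup_le_iff, cayDist_le_iff]
  exact ⟨fun h x => by simpa using h 1 x, fun h x y => h _⟩

theorem exists_cayDiam_of_reach {undir : Bool} {z : Fin k → G} {r : ℕ}
    (h : ∀ x, Reach undir z r x) : ∃ D : ℕ, cayDiam undir z = D ∧ D ≤ r := by
  have h' := cayDiam_le_iff.2 h
  obtain ⟨D, hD⟩ := ENat.ne_top_iff_exists.1 (ne_top_of_le_ne_top (ENat.natCast_ne_top r) h')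
  refine ⟨D, hD.symm, ?_⟩
  rw [← hD] at h'
  exact_mod_cast h'

theorem cayBallCard_of_cayDiam_eq [Fintype G] {undir : Bool} {z : Fin k → G} {D : ℕ}
    (h : cayDiam undir z = D) : cayBallCard undir z D = Fintype.card G := by
  rw [cayBallCard_eq, ← Nat.card_eq_fintype_card]
  exact Nat.card_congr (Equiv.subtypeUnivEquiv (cayDiam_le_iff.1 h.le))

theorem card_le_cayBallCard [Finite G] {undir : Bool} {z : Fin k → G} {r : ℕ} {s : Finset G}
    (h : ∀ x ∈ s, Reach undir z r x) : s.card ≤ cayBallCard undir z r := by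
  classical
  have := Fintype.ofFinite G
  rw [cayBallCard_eq, Nat.card_eq_fintype_card, Fintype.card_subtype]
  exact card_le_card fun x hx => by simpa using h x hx

end Words

section Abelian

variable {G : Type*} [CommGroup G] {k : ℕ}

theorem reach_prod_zpow {undir : Bool} (z : Fin k → G) (v : Fin k → ℤ)
    (hv : undir = false → ∀ i, 0 ≤ v i) {r : ℕ} (hr : ∑ i, (v i).natAbs ≤ r) :
    Reach undir z r (∏ i, z i ^ v i) := by
  have : ∀ s : Finset (Fin k), Reach undir z (∑ i ∈ s, (v i).natAbs) (∏ i ∈ s, z i ^ v i) := by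
    intro s
    induction s using Finset.induction_on with
    | empty => simpa using reach_one undir z
    | insert a s ha ih =>
      rw [sum_insert ha, prod_insert ha]
      exact (reach_zpow z a (v a) fun h => hv h a).mul ih
  exact (this univ).mono hr

theorem Reach.exists_prod_zpow {undir : Bool} {z : Fin k → G} {r : ℕ} {x : G}
    (h : Reach undir z r x) : ∃ v : Fin k → ℤ, (undir = false → ∀ i, 0 ≤ v i) ∧
      ∑ i, (v i).natAbs ≤ r ∧ x = ∏ i, z i ^ v i := by
  obtain ⟨l, hl, hu, rfl⟩ := h
  induction l generalizing r with
  | nil => exact ⟨0, by simp, by simp, by simp⟩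
  | cons a l ih =>
    obtain ⟨v, hv, hs, hx⟩ := ih (r := l.length) le_rfl (fun h b hb => hu h b (by simp [hb]))
    refine ⟨v + Pi.single a.1 (if a.2 then 1 else -1), ?_, ?_, ?_⟩
    · intro h i
      have h1 : a.2 = true := hu h a (by simp)
      have h2 := hv h i
      by_cases hi : i = a.1
      · subst hi; simp [h1, add_nonneg, h2]
      · simp [hi, h2]
    · calc ∑ i, ((v + Pi.single a.1 (if a.2 then 1 else -1) : Fin k → ℤ) i).natAbs
          ≤ ∑ i, ((v i).natAbs + if i = a.1 then 1 else 0) := by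
            refine sum_le_sum fun i _ => ?_
            by_cases hi : i = a.1
            · subst hi; simp; split_ifs <;> lia
            · simp [hi]
        _ ≤ r := by
            rw [sum_add_distrib]
            simp at hl ⊢
            lia
    · simp only [List.map_cons, List.prod_cons, hx, Pi.add_apply, zpow_add, prod_mul_distrib]
      rw [mul_comm]
      congr 1
      rw [Finset.prod_eq_single a.1]
      · simp [letterVal]
      · intro b _ hb; simp [hb]
      · simp

end Abelian

section LetterSeries

theorem sum_piFinset_prod {α : Type*} {k : ℕ} (s : Finset α) (f : α → ℝ) :
    ∑ v ∈ Fintype.piFinset fun _ : Fin k => s, ∏ i, f (v i) = (∑ j ∈ s, f j) ^ k := by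
  classical
  rw [← prod_univ_sum, prod_const, card_fin]

/-- Exponents of a single generator of absolute value at most `M`; only nonnegative ones are
allowed in the directed case. -/
noncomputable def letterBox (undir : Bool) (M : ℕ) : Finset ℤ :=
  (Icc (-(M : ℤ)) M).filter fun j => undir = false → 0 ≤ j

theorem mem_letterBox {undir : Bool} {M : ℕ} {j : ℤ} :
    j ∈ letterBox undir M ↔ j.natAbs ≤ M ∧ (undir = false → 0 ≤ j) := by
  simp only [letterBox, mem_filter, mem_Icc]
  refine and_congr_left fun _ => ?_
  lia

theorem sum_letterBox {undir : Bool} {M : ℕ} (f : ℕ → ℝ) :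
    ∑ j ∈ letterBox undir M, f j.natAbs =
      ∑ j ∈ range (M + 1), f j + if undir then ∑ j ∈ range M, f (j + 1) else 0 := by
  have h1 : ∑ j ∈ range (M + 1), f j =
      ∑ j ∈ (letterBox undir M).filter (fun j => 0 ≤ j), f j.natAbs := by
    refine sum_bij' (fun j _ => (j : ℤ)) (fun j _ => j.natAbs) ?_ ?_ ?_ ?_ ?_
    · intro a ha
      simp only [mem_filter, mem_letterBox, mem_range] at ha ⊢
      lia
    · intro a ha
      simp only [mem_filter, mem_letterBox, mem_range] at ha ⊢
      lia
    · intro a _; simp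
    · intro a ha
      simp only [mem_filter] at ha
      lia
    · intro a _; simp
  have h2 : (if undir then ∑ j ∈ range M, f (j + 1) else 0) =
      ∑ j ∈ (letterBox undir M).filter (fun j => ¬ 0 ≤ j), f j.natAbs := by
    cases undir
    · rw [if_neg (by simp)]
      symm
      refine sum_eq_zero fun j hj => ?_
      simp only [mem_filter, mem_letterBox] at hj
      exact absurd (hj.1.2 trivial) hj.2
    · rw [if_pos rfl]
      refine sum_bij' (fun j _ => -((j : ℤ) + 1)) (fun j _ => j.natAbs - 1) ?_ ?_ ?_ ?_ ?_
      · intro a ha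
        simp only [mem_filter, mem_letterBox, mem_range] at ha ⊢
        refine ⟨⟨by lia, by simp⟩, by lia⟩
      · intro a ha
        simp only [mem_filter, mem_letterBox, mem_range] at ha ⊢
        lia
      · intro a _; lia
      · intro a ha
        simp only [mem_filter] at ha
        lia
      · intro a _
        congr 1
  rw [h1, h2, sum_filter_add_sum_filter_not]

/-- The generating function `∑ t ^ |j|` over the exponents `j` of a single generator. -/
noncomputable def letterGF (undir : Bool) (t : ℝ) : ℝ :=
  (if undir then 1 + t else 1) / (1 - t)

/-- The series `∑ |j| t ^ |j|` over the exponents `j` of a single generator. -/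
noncomputable def letterMoment (undir : Bool) (t : ℝ) : ℝ :=
  (if undir then 2 * t else t) / (1 - t) ^ 2

theorem tendsto_sum_letterBox {undir : Bool} {f : ℕ → ℝ} {s : ℝ} (hf : HasSum f s) :
    Tendsto (fun M => ∑ j ∈ letterBox undir M, f j.natAbs) atTop
      (nhds (s + if undir then s - f 0 else 0)) := by
  simp only [sum_letterBox]
  have h1 : Tendsto (fun M => ∑ j ∈ range (M + 1), f j) atTop (nhds s) :=
    (tendsto_add_atTop_iff_nat 1).2 hf.tendsto_sum_nat
  refine h1.add ?_
  cases undir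
  · simp
  · simp only [if_true]
    have : (fun M => ∑ j ∈ range M, f (j + 1)) = fun M => ∑ j ∈ range (M + 1), f j - f 0 := by
      ext M; rw [sum_range_succ']; ring
    rw [this]
    exact h1.sub_const _

theorem tendsto_letterGF {undir : Bool} {t : ℝ} (h0 : 0 ≤ t) (h1 : t < 1) :
    Tendsto (fun M => ∑ j ∈ letterBox undir M, t ^ j.natAbs) atTop
      (nhds (letterGF undir t)) := by
  convert tendsto_sum_letterBox (undir := undir) (hasSum_geometric_of_lt_one h0 h1) using 2
  have : 1 - t ≠ 0 := by linarith
  cases undir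
  · simp [letterGF]
  · simp only [letterGF, if_true]; field_simp; ring

theorem tendsto_letterMoment {undir : Bool} {t : ℝ} (h0 : 0 ≤ t) (h1 : t < 1) :
    Tendsto (fun M => ∑ j ∈ letterBox undir M, (j.natAbs : ℝ) * t ^ j.natAbs) atTop
      (nhds (letterMoment undir t)) := by
  have hs : HasSum (fun n : ℕ => (n : ℝ) * t ^ n) (t / (1 - t) ^ 2) :=
    hasSum_coe_mul_geometric_of_norm_lt_one (by rwa [Real.norm_of_nonneg h0])
  convert tendsto_sum_letterBox (undir := undir) hs using 2
  cases undir
  · simp [letterMoment]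
  · simp only [letterMoment, if_true]; simp; ring

theorem sum_letterBox_le {undir : Bool} {t : ℝ} (h0 : 0 ≤ t) (h1 : t < 1) (M : ℕ) :
    ∑ j ∈ letterBox undir M, t ^ j.natAbs ≤ letterGF undir t := by
  refine Monotone.ge_of_tendsto (fun M N h => ?_) (tendsto_letterGF h0 h1) M
  refine sum_le_sum_of_subset_of_nonneg (fun j hj => ?_) fun _ _ _ => by positivity
  rw [mem_letterBox] at hj ⊢
  exact ⟨hj.1.trans h, hj.2⟩

theorem one_le_letterGF {undir : Bool} {t : ℝ} (h0 : 0 ≤ t) (h1 : t < 1) :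
    1 ≤ letterGF undir t := by
  have : 0 < 1 - t := by linarith
  rw [letterGF, le_div_iff₀ this]
  split_ifs <;> linarith

theorem letterGF_le {undir : Bool} {t : ℝ} (h0 : 0 ≤ t) (h1 : t < 1) :
    letterGF undir t ≤ (1 + t) / (1 - t) := by
  have : 0 < 1 - t := by linarith
  rw [letterGF]
  gcongr
  split_ifs <;> linarith

/-- Balls in Cayley graphs of Abelian groups are no larger than the corresponding balls
of exponent vectors, whose size is bounded by an exponential Chebyshev inequality. -/
theorem cayBallCard_mul_pow_le {G : Type*} [CommGroup G] [Fintype G] {undir : Bool} {k : ℕ}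
    (z : Fin k → G) {t : ℝ} (h0 : 0 < t) (h1 : t < 1) (r : ℕ) :
    (cayBallCard undir z r : ℝ) * t ^ r ≤ letterGF undir t ^ k := by
  classical
  set B : Finset (Fin k → ℤ) :=
    (Fintype.piFinset fun _ => letterBox undir r).filter fun v => ∑ i, (v i).natAbs ≤ r with hB
  have hcard : cayBallCard undir z r ≤ B.card := by
    rw [cayBallCard_eq, Nat.card_eq_fintype_card, Fintype.card_subtype]
    refine card_le_card_of_surjOn (fun v => ∏ i, z i ^ v i) fun x hx => ?_
    simp only [coe_filter, Set.mem_ofPred_eq, mem_univ, true_and] at hx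
    obtain ⟨v, hv, hs, rfl⟩ := hx.exists_prod_zpow
    refine ⟨v, ?_, rfl⟩
    simp only [hB, coe_filter, Set.mem_ofPred_eq, Fintype.mem_piFinset, mem_letterBox]
    exact ⟨fun i => ⟨(single_le_sum (f := fun i => (v i).natAbs) (fun _ _ => Nat.zero_le _)
      (mem_univ i)).trans hs, fun h => hv h i⟩, hs⟩
  calc (cayBallCard undir z r : ℝ) * t ^ r ≤ B.card * t ^ r := by gcongr
    _ = ∑ v ∈ B, t ^ r := by rw [sum_const, nsmul_eq_mul]
    _ ≤ ∑ v ∈ B, ∏ i, t ^ (v i).natAbs := by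
        refine sum_le_sum fun v hv => ?_
        rw [prod_pow_eq_pow_sum]
        exact pow_le_pow_of_le_one h0.le h1.le (mem_filter.1 hv).2
    _ ≤ ∑ v ∈ Fintype.piFinset fun _ => letterBox undir r, ∏ i, t ^ (v i).natAbs :=
        sum_le_sum_of_subset_of_nonneg (filter_subset _ _) fun _ _ _ => by positivity
    _ = (∑ j ∈ letterBox undir r, t ^ j.natAbs) ^ k := by
        exact sum_piFinset_prod (letterBox undir r) fun j => t ^ j.natAbs
    _ ≤ letterGF undir t ^ k := by
        gcongr
        exact sum_letterBox_le h0.le h1 r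

/-- The logarithmic form of the volume bound. -/
theorem log_cayBallCard_le {G : Type*} [CommGroup G] [Fintype G] {undir : Bool} {k : ℕ}
    (z : Fin k → G) {t : ℝ} (h0 : 0 < t) (h1 : t < 1) (r : ℕ) {c : ℝ} (hc : 0 < c)
    (hcr : c ≤ cayBallCard undir z r) :
    Real.log c ≤ k * Real.log (letterGF undir t) + r * Real.log t⁻¹ := by
  have h := cayBallCard_mul_pow_le (undir := undir) z h0 h1 r
  have hF := one_le_letterGF (undir := undir) h0.le h1
  have h2 : c * t ^ r ≤ letterGF undir t ^ k := le_trans (by gcongr) h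
  have h3 := Real.log_le_log (by positivity) h2
  rw [Real.log_mul (by positivity) (by positivity), Real.log_pow, Real.log_pow] at h3
  rw [Real.log_inv]
  linarith

end LetterSeries

section TupleProb

variable {G : Type*} [Fintype G] {k : ℕ}

theorem tupleProb_eq_sum [DecidableEq G] (p : (Fin k → G) → Prop) [DecidablePred p] :
    tupleProb G k p = (∑ z, if p z then (1 : ℝ) else 0) / (Fintype.card G : ℝ) ^ k := by
  rw [tupleProb, Nat.card_eq_fintype_card, Fintype.card_subtype, sum_boole]

theorem sum_const_div_card_pow [Nonempty G] (c : ℝ) :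
    (∑ _z : Fin k → G, c) / (Fintype.card G : ℝ) ^ k = c := by
  have : (Fintype.card G : ℝ) ≠ 0 := by simp
  rw [sum_const, card_univ, Fintype.card_fun, Fintype.card_fin, nsmul_eq_mul]
  push_cast
  field_simp

/-- The Markov inequality for uniform tuples. -/
theorem tupleProb_mul_le {p : (Fin k → G) → Prop} {Y : (Fin k → G) → ℝ} {c : ℝ}
    (hY : ∀ z, 0 ≤ Y z) (hp : ∀ z, p z → c ≤ Y z) :
    tupleProb G k p * c ≤ (∑ z, Y z) / (Fintype.card G : ℝ) ^ k := by
  classical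
  rw [tupleProb_eq_sum, div_mul_eq_mul_div, sum_mul]
  gcongr with z
  split_ifs with h
  · simpa using hp z h
  · simpa using hY z

theorem tupleProb_nonneg (p : (Fin k → G) → Prop) : 0 ≤ tupleProb G k p := by
  rw [tupleProb]; positivity

theorem tupleProb_mono {p q : (Fin k → G) → Prop} (h : ∀ z, p z → q z) :
    tupleProb G k p ≤ tupleProb G k q := by
  classical
  rw [tupleProb_eq_sum, tupleProb_eq_sum]
  gcongr with z
  split_ifs with h1 h2 h2
  · exact le_rfl
  · exact absurd (h z h1) h2
  · exact zero_le_one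
  · exact le_rfl

theorem tupleProb_not [Nonempty G] (p : (Fin k → G) → Prop) :
    tupleProb G k (fun z => ¬ p z) = 1 - tupleProb G k p := by
  classical
  rw [eq_sub_iff_add_eq, tupleProb_eq_sum, tupleProb_eq_sum, ← add_div, ← sum_add_distrib]
  rw [← sum_const_div_card_pow (G := G) (k := k) 1]
  congr 1
  refine sum_congr rfl fun z _ => ?_
  by_cases h : p z <;> simp [h]

theorem tupleProb_le_one [Nonempty G] (p : (Fin k → G) → Prop) : tupleProb G k p ≤ 1 := by
  have := tupleProb_not p
  have := tupleProb_nonneg (fun z => ¬ p z)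
  linarith

theorem tupleProb_exists_le {α : Type*} (s : Finset α) (p : α → (Fin k → G) → Prop) :
    tupleProb G k (fun z => ∃ a ∈ s, p a z) ≤ ∑ a ∈ s, tupleProb G k (p a) := by
  classical
  simp only [tupleProb_eq_sum]
  rw [← sum_div, sum_comm]
  gcongr with z
  split_ifs with h
  · obtain ⟨a, ha, hp⟩ := h
    refine le_trans ?_ (single_le_sum (f := fun a => if p a z then (1 : ℝ) else 0)
      (fun a _ => by positivity) ha)
    simp [hp]
  · exact sum_nonneg fun a _ => by positivity

/-- The probability that all coordinates lie in a given set. -/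
theorem tupleProb_forall_mem (s : Finset G) :
    tupleProb G k (fun z => ∀ i, z i ∈ s) = ((s.card : ℝ) / Fintype.card G) ^ k := by
  classical
  rw [tupleProb, Nat.card_eq_fintype_card, Fintype.card_subtype, div_pow]
  congr 1
  have : (univ.filter fun z : Fin k → G => ∀ i, z i ∈ s) = Fintype.piFinset fun _ => s := by
    ext z; simp
  rw [this, Fintype.card_piFinset_const]
  push_cast; rfl

/-- Splitting a uniform tuple into two independent uniform tuples. -/
theorem tupleProb_append {a b : ℕ} (p : (Fin (a + b) → G) → Prop) :
    tupleProb G (a + b) p =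
      (∑ z : Fin a → G, tupleProb G b fun y => p (Fin.append z y)) / (Fintype.card G : ℝ) ^ a := by
  classical
  simp only [tupleProb_eq_sum]
  rw [← sum_div, div_div, ← Fintype.sum_prod_type', pow_add, mul_comm (_ ^ a)]
  congr 1
  exact (Fintype.sum_equiv (Fin.appendEquiv a b) _ _ fun _ => rfl).symm

/-- The second moment method: a random map with nearly pairwise independent values hits
almost all points. -/
theorem tupleProb_card_image_lt {ι : Type*} [DecidableEq G] [Nonempty G] (I : Finset ι) (q : ι → ℝ)
    (hq : ∀ a ∈ I, 0 ≤ q a) (φ : ι → (Fin k → G) → G) {η δ : ℝ} (hδ : 0 < δ)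
    (hS : 0 < ∑ a ∈ I, q a)
    (h : (Fintype.card G : ℝ) * ∑ a ∈ I, ∑ b ∈ I,
      q a * q b * tupleProb G k (fun z => φ a z = φ b z) ≤ (∑ a ∈ I, q a) ^ 2 * (1 + η)) :
    tupleProb G k (fun z => ((I.image fun a => φ a z).card : ℝ) < (1 - δ) * Fintype.card G)
      ≤ η / δ := by
  classical
  set n : ℝ := (Fintype.card G : ℝ) with hn
  set S := ∑ a ∈ I, q a with hSdef
  have hn0 : 0 < n := by simp [hn, Fintype.card_pos]
  set Q : (Fin k → G) → ℝ := fun z => ∑ a ∈ I, ∑ b ∈ I, if φ a z = φ b z then q a * q b else 0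
    with hQ
  have hCS : ∀ z, S ^ 2 ≤ ((I.image fun a => φ a z).card : ℝ) * Q z := by
    intro z
    set U := I.image fun a => φ a z
    have hmaps : ∀ a ∈ I, φ a z ∈ U := fun a ha => mem_image_of_mem (fun a => φ a z) ha
    have e1 : S = ∑ x ∈ U, ∑ a ∈ I with φ a z = x, q a :=
      (sum_fiberwise_of_maps_to hmaps _).symm
    have e2 : Q z = ∑ x ∈ U, (∑ a ∈ I with φ a z = x, q a) ^ 2 := by
      rw [hQ]
      simp only
      rw [← sum_fiberwise_of_maps_to hmaps]
      refine sum_congr rfl fun x _ => ?_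
      rw [sq, sum_mul]
      refine sum_congr rfl fun a ha => ?_
      rw [mul_sum, sum_filter]
      refine sum_congr rfl fun b _ => ?_
      rw [(mem_filter.1 ha).2]
      simp only [eq_comm]
    rw [e1, e2]
    exact sq_sum_le_card_mul_sum_sq
  have hQ0 : ∀ z, 0 ≤ Q z := fun z => sum_nonneg fun a ha => sum_nonneg fun b hb => by
    have := hq a ha
    have := hq b hb
    positivity
  have hle : ∀ z, ((I.image fun a => φ a z).card : ℝ) ≤ n := fun z => by
    rw [hn]; exact_mod_cast card_le_univ _
  have hmean : (∑ z, (n * Q z - S ^ 2)) / n ^ k ≤ S ^ 2 * η := by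
    rw [sum_sub_distrib, sub_div, sum_const_div_card_pow, ← mul_sum]
    have : n * (∑ z, Q z) / n ^ k =
        n * ∑ a ∈ I, ∑ b ∈ I, q a * q b * tupleProb G k (fun z => φ a z = φ b z) := by
      rw [mul_div_assoc]
      congr 1
      simp only [hQ, tupleProb_eq_sum]
      rw [sum_comm, sum_div]
      refine sum_congr rfl fun a _ => ?_
      rw [sum_comm, sum_div]
      refine sum_congr rfl fun b _ => ?_
      rw [← mul_div_assoc, mul_sum]
      simp only [mul_ite, mul_one, mul_zero]
      rfl
    rw [this]
    linarith
  have key : tupleProb G k (fun z => ((I.image fun a => φ a z).card : ℝ) < (1 - δ) * n) *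
      (δ * S ^ 2) ≤ S ^ 2 * η := by
    refine (tupleProb_mul_le (Y := fun z => n * Q z - S ^ 2) (fun z => ?_) fun z hz => ?_).trans
      hmean
    · have := mul_le_mul_of_nonneg_right (hle z) (hQ0 z)
      linarith [hCS z]
    · have h1 : S ^ 2 ≤ (1 - δ) * n * Q z :=
        (hCS z).trans (mul_le_mul_of_nonneg_right hz.le (hQ0 z))
      nlinarith [mul_nonneg hn0.le (hQ0 z), mul_nonneg (sq_nonneg δ) (mul_nonneg hn0.le (hQ0 z))]
  rw [le_div_iff₀ hδ]
  have hS2 : 0 < S ^ 2 := by positivity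
  nlinarith

end TupleProb

section Cover

variable {G : Type*} [Group G] [Fintype G]

/-- If a ball contains all but a `δ`-fraction of the group, then a further `b` independent
generators turn it into the whole group, up to an error `|G| δ ^ b`. -/
theorem tupleProb_not_reach_le (undir : Bool) {k a b : ℕ} (hk : k = a + b) (r : ℕ) {δ : ℝ}
    (hδ : 0 ≤ δ) :
    tupleProb G k (fun z => ¬ ∀ x, Reach undir z (r + 1) x) ≤
      tupleProb G a (fun z => (cayBallCard undir z r : ℝ) < (1 - δ) * Fintype.card G) +
        Fintype.card G * δ ^ b := by
  classical
  subst hk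
  have hn0 : (0 : ℝ) < Fintype.card G := by exact_mod_cast Fintype.card_pos
  rw [tupleProb_append]
  have hsum : ∀ z : Fin a → G,
      (tupleProb G b fun y => ¬ ∀ x, Reach undir (Fin.append z y) (r + 1) x) ≤
        (if (cayBallCard undir z r : ℝ) < (1 - δ) * Fintype.card G then 1 else 0) +
          Fintype.card G * δ ^ b := by
    intro z
    split_ifs with hz
    · have := tupleProb_le_one (G := G)
        (fun y : Fin b → G => ¬ ∀ x, Reach undir (Fin.append z y) (r + 1) x)
      have : 0 ≤ (Fintype.card G : ℝ) * δ ^ b := by positivity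
      linarith
    · rw [zero_add]
      set A : Finset G := univ.filter fun x => Reach undir z r x with hA
      have hcard : cayBallCard undir z r = A.card := by
        rw [cayBallCard_eq, Nat.card_eq_fintype_card, Fintype.card_subtype]
      have hstep : ∀ y : Fin b → G, (¬ ∀ x, Reach undir (Fin.append z y) (r + 1) x) →
          ∃ x ∈ (univ : Finset G), ∀ i, y i ∈ (Aᶜ).image fun u => u⁻¹ * x := by
        intro y hy
        push Not at hy
        obtain ⟨x, hx⟩ := hy
        refine ⟨x, mem_univ _, fun i => ?_⟩
        refine mem_image.2 ⟨x * (y i)⁻¹, ?_, by group⟩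
        rw [mem_compl, hA, mem_filter]
        rintro ⟨-, hr⟩
        apply hx
        have h1 : Reach undir (Fin.append z y) r (x * (y i)⁻¹) := by
          apply Reach.comp (Fin.castAdd b)
          simpa using hr
        have h2 := h1.mul (reach_generator undir (Fin.append z y) (Fin.natAdd a i))
        simpa using h2
      refine (tupleProb_mono hstep).trans ((tupleProb_exists_le _ _).trans ?_)
      have : ∀ x ∈ (univ : Finset G),
          tupleProb G b (fun y => ∀ i, y i ∈ (Aᶜ).image fun u => u⁻¹ * x) ≤ δ ^ b := by
        intro x _
        rw [tupleProb_forall_mem]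
        gcongr
        rw [div_le_iff₀ hn0]
        have h1 : (((Aᶜ).image fun u => u⁻¹ * x).card : ℝ) ≤ (Aᶜ.card : ℝ) := by
          exact_mod_cast card_image_le
        have h2 : (Aᶜ.card : ℝ) = Fintype.card G - A.card := by
          rw [card_compl, Nat.cast_sub (card_le_univ _)]
        rw [hcard] at hz
        linarith
      refine (sum_le_sum this).trans ?_
      rw [sum_const, card_univ, nsmul_eq_mul]
  calc _ ≤ (∑ z : Fin a → G, ((if (cayBallCard undir z r : ℝ) < (1 - δ) * Fintype.card G
        then (1 : ℝ) else 0) + Fintype.card G * δ ^ b)) / (Fintype.card G : ℝ) ^ a := by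
        gcongr with z
        exact hsum z
    _ = _ := by
        rw [sum_add_distrib, add_div, sum_const_div_card_pow, ← tupleProb_eq_sum]

end Cover

section PairwiseIndependence

variable {G : Type*} [Group G] [Fintype G] {k : ℕ}

theorem tupleProb_eq_of_update (φ ψ : (Fin k → G) → G) (i : Fin k)
    (hφ : ∀ z, Function.Injective fun u => φ (Function.update z i u))
    (hψ : ∀ z u, ψ (Function.update z i u) = ψ z) :
    tupleProb G k (fun z => φ z = ψ z) = 1 / Fintype.card G := by
  classical
  have hn0 : (Fintype.card G : ℝ) ≠ 0 := by simp
  obtain ⟨m, rfl⟩ : ∃ m, k = m + 1 := ⟨k - 1, by have := i.pos; lia⟩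
  set e := Equiv.funSplitAt i G with he
  have hupd : ∀ u y, e.symm (u, y) = Function.update (e.symm (1, y)) i u := by
    intro u y
    ext j
    by_cases hj : j = i
    · subst hj; simp [he, Equiv.funSplitAt]
    · simp [he, Equiv.funSplitAt, hj]
  have hfib : ∀ y, ∑ u : G, (if φ (e.symm (u, y)) = ψ (e.symm (u, y)) then (1 : ℝ) else 0) = 1 := by
    intro y
    set z := e.symm (1, y)
    have hb : Function.Bijective fun u => φ (Function.update z i u) :=
      Finite.injective_iff_bijective.1 (hφ z)
    rw [sum_congr rfl fun u _ => by rw [hupd u y],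
      Fintype.sum_equiv (Equiv.ofBijective _ hb) _ (fun v => if v = ψ z then (1 : ℝ) else 0)]
    · simp
    · intro u
      rw [hψ]
      rfl
  rw [tupleProb_eq_sum, Fintype.sum_equiv e _
    (fun x => if φ (e.symm x) = ψ (e.symm x) then (1 : ℝ) else 0) (by simp),
    Fintype.sum_prod_type_right, sum_congr rfl fun y _ => hfib y, sum_const, card_univ,
    Fintype.card_fun, Fintype.card_subtype_compl, Fintype.card_fin]
  simp only [Fintype.card_unique, nsmul_eq_mul, mul_one, Nat.add_sub_cancel]
  push_cast
  field_simp
  rw [pow_succ]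

/-- Words picking one generator out of each of `L` blocks of `B` generators have pairwise
independent values, so the ball of radius `L` covers almost all of the group as soon as
`B ^ L` is much larger than `|G|`. -/
theorem tupleProb_card_ball_lt_of_blocks {L B : ℕ} (hk : L * B ≤ k) (hB : 0 < B) {δ : ℝ}
    (hδ : 0 < δ) (undir : Bool) :
    tupleProb G k (fun z => (cayBallCard undir z L : ℝ) < (1 - δ) * Fintype.card G) ≤
      Fintype.card G / (B : ℝ) ^ L / δ := by
  classical
  have hn0 : (Fintype.card G : ℝ) ≠ 0 := by simp
  set e : Fin L → Fin B → Fin k := fun i j => Fin.castLE hk (finProdFinEquiv (i, j)) with he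
  have einj : ∀ i j i' j', e i j = e i' j' → i = i' ∧ j = j' := by
    intro i j i' j' h
    have := finProdFinEquiv.injective (Fin.castLE_injective hk h)
    simpa using this
  set φ : (Fin L → Fin B) → (Fin k → G) → G :=
    fun a z => (List.ofFn fun j => z (e j (a j))).prod with hφ
  have hpair : ∀ a b, a ≠ b → tupleProb G k (fun z => φ a z = φ b z) = 1 / Fintype.card G := by
    intro a b hab
    obtain ⟨j, hj⟩ := Function.ne_iff.1 hab
    refine tupleProb_eq_of_update _ _ (e j (a j)) (fun z => ?_) fun z u => ?_
    · have hset : ∀ u, φ a (Function.update z (e j (a j)) u) =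
          ((List.ofFn fun j => z (e j (a j))).set j u).prod := by
        intro u
        simp only [hφ]
        congr 1
        refine List.ext_getElem (by simp) fun m h1 h2 => ?_
        rw [List.getElem_set]
        simp only [List.getElem_ofFn]
        split_ifs with h
        · have : (⟨m, by simpa using h1⟩ : Fin L) = j := Fin.ext h.symm
          rw [this, Function.update_self]
        · rw [Function.update_of_ne]
          intro h'
          exact h (congrArg Fin.val (einj _ _ _ _ h').1).symm
      intro u v huv
      simp only [hset, List.prod_set, List.length_ofFn, j.isLt, if_true] at huv
      simpa using huv
    · simp only [hφ]
      congr 2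
      ext j'
      rw [Function.update_of_ne]
      intro h'
      obtain ⟨rfl, h2⟩ := einj _ _ _ _ h'
      exact hj h2.symm
  have hcard : ∑ _a ∈ (univ : Finset (Fin L → Fin B)), (1 : ℝ) = (B : ℝ) ^ L := by simp
  have hBL : (0 : ℝ) < (B : ℝ) ^ L := by positivity
  refine (tupleProb_mono fun z hz => ?_).trans
    (tupleProb_card_image_lt univ (fun _ => (1 : ℝ)) (fun _ _ => zero_le_one) φ hδ
      (by rw [hcard]; exact hBL) ?_)
  · refine lt_of_le_of_lt ?_ hz
    exact_mod_cast card_le_cayBallCard fun x hx => by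
      obtain ⟨a, -, rfl⟩ := mem_image.1 hx
      exact reach_ofFn_prod undir z _
  · rw [hcard]
    have hle : ∀ a b, 1 * 1 * tupleProb G k (fun z => φ a z = φ b z) ≤
        1 / Fintype.card G + if a = b then 1 else 0 := by
      intro a b
      split_ifs with h
      · have := tupleProb_le_one (fun z : Fin k → G => φ a z = φ b z)
        have : 0 ≤ 1 / (Fintype.card G : ℝ) := by positivity
        linarith
      · rw [hpair a b h]; simp
    calc _ ≤ (Fintype.card G : ℝ) * ∑ a : Fin L → Fin B, ∑ b : Fin L → Fin B,
          (1 / (Fintype.card G : ℝ) + if a = b then 1 else 0) := by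
          gcongr with a _ b _
          exact hle a b
      _ = _ := by
          simp only [sum_add_distrib, sum_ite_eq, mem_univ, if_true, sum_const, card_univ,
            Fintype.card_fun, Fintype.card_fin, nsmul_eq_mul]
          push_cast
          field_simp

end PairwiseIndependence

section AbelianCollisions

variable {G : Type*} [CommGroup G] [Fintype G] {k : ℕ}

theorem card_le_pow_minGen_mul_card_range_pow {g : ℕ} (hg : 0 < g) :
    Nat.card G ≤ g ^ minGen G * Nat.card (powMonoidHom g : G →* G).range := by
  classical
  set H := (powMonoidHom g : G →* G).range with hH
  rw [Subgroup.card_eq_card_quotient_mul_card_subgroup H]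
  gcongr
  have h1 : Nat.card (G ⧸ H) ∣ g ^ Group.rank (G ⧸ H) := by
    refine card_dvd_exponent_pow_rank' (G ⧸ H) fun x => ?_
    obtain ⟨y, rfl⟩ := QuotientGroup.mk_surjective x
    rw [← QuotientGroup.mk_pow, QuotientGroup.eq_one_iff]
    exact ⟨y, rfl⟩
  have h2 : Group.rank (G ⧸ H) ≤ minGen G := by
    refine (Group.rank_le_of_surjective _ (QuotientGroup.mk'_surjective H)).trans ?_
    have hne : {n : ℕ | ∃ s : Finset G, s.card = n ∧ Subgroup.closure (s : Set G) = ⊤}.Nonempty :=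
      ⟨_, univ, rfl, by simp⟩
    obtain ⟨s, hs, hs'⟩ := Nat.sInf_mem hne
    exact (Group.rank_le hs').trans hs.le
  exact (Nat.le_of_dvd (by positivity) h1).trans (Nat.pow_le_pow_right hg h2)

/-- Evaluating an exponent vector at uniform generators gives a uniform element of a subgroup
containing all `g`-th powers, where `g` is the greatest common divisor of the exponents. -/
theorem card_mul_tupleProb_prod_zpow_le (v : Fin k → ℤ) {g : ℕ} (hg : 0 < g) {c : Fin k → ℤ}
    (hc : ∑ i, c i * v i = g) :
    (Fintype.card G : ℝ) * tupleProb G k (fun z => ∏ i, z i ^ v i = 1) ≤ (g : ℝ) ^ minGen G := by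
  classical
  set f : (Fin k → G) →* G :=
    { toFun := fun z => ∏ i, z i ^ v i
      map_one' := by simp
      map_mul' := fun x y => by simp [mul_zpow, prod_mul_distrib] } with hf
  have hrange : (powMonoidHom g : G →* G).range ≤ f.range := by
    rintro _ ⟨u, rfl⟩
    refine ⟨fun i => u ^ c i, ?_⟩
    simp only [hf, MonoidHom.coe_mk, OneHom.coe_mk, ← zpow_mul]
    have hpow : ∀ s : Finset (Fin k), ∏ i ∈ s, u ^ (c i * v i) = u ^ ∑ i ∈ s, c i * v i := by
      intro s
      induction s using Finset.induction_on with
      | empty => simp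
      | insert a s ha ih => rw [prod_insert ha, sum_insert ha, ih, zpow_add]
    rw [hpow, hc]
    simp
  have hcard : Nat.card f.ker * Nat.card f.range = Fintype.card G ^ k := by
    rw [← Subgroup.index_ker, Subgroup.card_mul_index, Nat.card_eq_fintype_card,
      Fintype.card_fun, Fintype.card_fin]
  have hprob : tupleProb G k (fun z => ∏ i, z i ^ v i = 1) =
      (Nat.card f.ker : ℝ) / (Fintype.card G : ℝ) ^ k := rfl
  have hle : Nat.card G ≤ g ^ minGen G * Nat.card f.range :=
    (card_le_pow_minGen_mul_card_range_pow hg).trans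
      (Nat.mul_le_mul_left _ (Subgroup.card_le_of_le hrange))
  rw [hprob, ← Nat.cast_pow, ← hcard]
  have h1 : (0 : ℝ) < Nat.card f.ker := by exact_mod_cast Nat.card_pos
  have h2 : (0 : ℝ) < Nat.card f.range := by exact_mod_cast Nat.card_pos
  have h3 : (Fintype.card G : ℝ) ≤ (g : ℝ) ^ minGen G * Nat.card f.range := by
    rw [← Nat.card_eq_fintype_card]; exact_mod_cast hle
  push_cast
  rw [← mul_div_assoc, div_le_iff₀ (by positivity)]
  calc (Fintype.card G : ℝ) * Nat.card f.ker
      ≤ ((g : ℝ) ^ minGen G * Nat.card f.range) * Nat.card f.ker := by gcongr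
    _ = _ := by ring

/-- The collision probability of two exponent vectors whose difference has entries of absolute
value at most `K`. -/
theorem card_mul_tupleProb_prod_zpow_le_sum (v : Fin k → ℤ) {K : ℕ}
    (hK : ∀ i, (v i).natAbs ≤ K) :
    (Fintype.card G : ℝ) * tupleProb G k (fun z => ∏ i, z i ^ v i = 1) ≤
      1 + (if v = 0 then (Fintype.card G : ℝ) else 0) +
        ∑ g ∈ Icc 2 K, (K : ℝ) ^ minGen G * if ∀ i, (g : ℤ) ∣ v i then 1 else 0 := by
  classical
  have hsum : 0 ≤ ∑ g ∈ Icc 2 K, (K : ℝ) ^ minGen G * if ∀ i, (g : ℤ) ∣ v i then (1 : ℝ) else 0 :=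
    sum_nonneg fun g _ => by positivity
  by_cases hv : v = 0
  · have h1 := tupleProb_le_one (fun z : Fin k → G => ∏ i, z i ^ v i = 1)
    have h2 : (0 : ℝ) ≤ Fintype.card G := by positivity
    rw [if_pos hv]
    nlinarith
  rw [if_neg hv, add_zero]
  obtain ⟨i, hi⟩ := Function.ne_iff.1 hv
  set I : Ideal ℤ := Ideal.span (Set.range v) with hI
  set g := (Submodule.IsPrincipal.generator I).natAbs with hg
  have hspan : I = Ideal.span {(g : ℤ)} := by
    rw [hg, Int.span_natAbs, Ideal.span_singleton_generator]
  have hdvd : ∀ i, (g : ℤ) ∣ v i := fun i => by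
    rw [← Ideal.mem_span_singleton, ← hspan]
    exact Ideal.subset_span ⟨i, rfl⟩
  have hgmem : (g : ℤ) ∈ I := by
    rw [hspan]; exact Ideal.mem_span_singleton_self _
  obtain ⟨c, hc⟩ := (Ideal.mem_span_range_iff_exists_fun).1 hgmem
  have hg0 : 0 < g := by
    rcases Nat.eq_zero_or_pos g with h | h
    · have := hdvd i
      rw [h] at this
      exact absurd (zero_dvd_iff.1 (by simpa using this)) hi
    · exact h
  have hgK : g ≤ K := by
    refine le_trans (Nat.le_of_dvd (Int.natAbs_pos.2 hi) ?_) (hK i)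
    exact Int.natCast_dvd.1 (hdvd i)
  have hmain := card_mul_tupleProb_prod_zpow_le (G := G) v hg0 hc
  rcases (show 1 ≤ g from hg0).lt_or_eq with h1 | h1
  · have hmem : g ∈ Icc 2 K := mem_Icc.2 ⟨h1, hgK⟩
    have := single_le_sum (f := fun g : ℕ => (K : ℝ) ^ minGen G *
      if ∀ i, (g : ℤ) ∣ v i then (1 : ℝ) else 0) (fun g _ => by positivity) hmem
    simp only [hdvd, implies_true, if_true, mul_one] at this
    have h3 : (g : ℝ) ^ minGen G ≤ (K : ℝ) ^ minGen G := by gcongr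
    linarith
  · rw [← h1] at hmain
    simp only [Nat.cast_one, one_pow] at hmain
    linarith

end AbelianCollisions

section RandomExponents

/-- Two independent random exponent vectors are unlikely to be congruent modulo `g ≥ 2`. -/
theorem sum_congruent_le {k : ℕ} {s : Finset ℤ} {p : ℤ → ℝ} (hp : ∀ j ∈ s, 0 ≤ p j)
    (hsum : ∑ j ∈ s, p j = 1) (h0 : (0 : ℤ) ∈ s) (h1 : (1 : ℤ) ∈ s) {g : ℕ} (hg : 2 ≤ g) :
    (∑ v ∈ Fintype.piFinset fun _ : Fin k => s, ∑ w ∈ Fintype.piFinset fun _ : Fin k => s,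
      (∏ i, p (v i)) * (∏ i, p (w i)) * if ∀ i, (g : ℤ) ∣ v i - w i then (1 : ℝ) else 0) ≤
      (1 - p 0 * p 1) ^ k := by
  classical
  set f : ℤ → ℤ → ℝ := fun a b => p a * p b * if (g : ℤ) ∣ a - b then 1 else 0 with hf
  have hf0 : ∀ a ∈ s, ∀ b ∈ s, 0 ≤ f a b := fun a ha b hb => by
    have := hp a ha
    have := hp b hb
    simp only [hf]
    positivity
  have e1 : ∀ v w : Fin k → ℤ, (∏ i, p (v i)) * (∏ i, p (w i)) *
      (if ∀ i, (g : ℤ) ∣ v i - w i then (1 : ℝ) else 0) = ∏ i, f (v i) (w i) := by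
    intro v w
    simp only [hf, prod_mul_distrib, prod_boole, mem_univ, true_implies]
  simp only [e1]
  have e2 : ∀ v : Fin k → ℤ, ∑ w ∈ Fintype.piFinset fun _ : Fin k => s, ∏ i, f (v i) (w i) =
      ∏ i, ∑ b ∈ s, f (v i) b := fun v => by
    rw [prod_univ_sum]
  rw [sum_congr rfl fun v _ => e2 v, sum_piFinset_prod s fun a => ∑ b ∈ s, f a b]
  refine pow_le_pow_left₀ (sum_nonneg fun a ha => sum_nonneg fun b hb => hf0 a ha b hb) ?_ k
  have htot : ∑ a ∈ s, ∑ b ∈ s, p a * p b = 1 := by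
    rw [← sum_mul_sum, hsum, one_mul]
  have hnot : ¬ (g : ℤ) ∣ 0 - 1 := by
    intro h
    have := Int.le_of_dvd one_pos ((dvd_neg.2 h).trans (by norm_num))
    lia
  have hgap : p 0 * p 1 ≤ ∑ a ∈ s, ∑ b ∈ s, (p a * p b - f a b) := by
    have hnn : ∀ a ∈ s, ∀ b ∈ s, 0 ≤ p a * p b - f a b := fun a ha b hb => by
      have h1 := mul_nonneg (hp a ha) (hp b hb)
      simp only [hf]
      split_ifs <;> linarith
    calc p 0 * p 1 = p 0 * p 1 - f 0 1 := by simp only [hf, if_neg hnot]; ring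
      _ ≤ ∑ b ∈ s, (p 0 * p b - f 0 b) :=
          single_le_sum (f := fun b => p 0 * p b - f 0 b) (hnn 0 h0) h1
      _ ≤ _ := single_le_sum (f := fun a => ∑ b ∈ s, (p a * p b - f a b))
          (fun a ha => sum_nonneg (hnn a ha)) h0
  simp only [sum_sub_distrib] at hgap
  linarith

variable {G : Type*} [CommGroup G] [Fintype G] {k : ℕ}

/-- Weighted second moment bound for balls in random Cayley graphs of Abelian groups: the
weights are those of independent letters conditioned to give a short exponent vector of
small probability. -/
theorem tupleProb_card_ball_lt_of_letters (undir : Bool) {M : ℕ} (hM : 1 ≤ M) {p : ℤ → ℝ}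
    (hp : ∀ j ∈ letterBox undir M, 0 ≤ p j) (hsum : ∑ j ∈ letterBox undir M, p j = 1)
    {r : ℕ} {Q δ : ℝ} (hδ : 0 < δ)
    (hS : (1 / 2 : ℝ) ≤ ∑ v ∈ (Fintype.piFinset fun _ : Fin k => letterBox undir M).filter
      (fun v => ∑ i, (v i).natAbs ≤ r ∧ ∏ i, p (v i) ≤ Q), ∏ i, p (v i)) :
    tupleProb G k (fun z => (cayBallCard undir z r : ℝ) < (1 - δ) * Fintype.card G) ≤
      4 * (Fintype.card G * Q +
        (2 * M) * ((2 * M : ℕ) : ℝ) ^ minGen G * (1 - p 0 * p 1) ^ k) / δ := by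
  classical
  have hn0 : (0 : ℝ) < Fintype.card G := by exact_mod_cast Fintype.card_pos
  set P := Fintype.piFinset fun _ : Fin k => letterBox undir M with hP
  set I := P.filter (fun v => ∑ i, (v i).natAbs ≤ r ∧ ∏ i, p (v i) ≤ Q) with hI
  set q : (Fin k → ℤ) → ℝ := fun v => ∏ i, p (v i) with hq
  set S := ∑ v ∈ I, q v with hSdef
  have hqP : ∀ v ∈ P, 0 ≤ q v := fun v hv =>
    prod_nonneg fun i _ => hp _ (Fintype.mem_piFinset.1 hv i)
  have hqI : ∀ v ∈ I, 0 ≤ q v := fun v hv => hqP v (mem_filter.1 hv).1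
  have hPsum : ∑ v ∈ P, q v = 1 := by
    rw [hP, hq]; simp only; rw [sum_piFinset_prod, hsum, one_pow]
  have hS1 : S ≤ 1 := by
    rw [← hPsum]
    exact sum_le_sum_of_subset_of_nonneg (filter_subset _ _) fun v hv _ => hqP v hv
  have h0 : (0 : ℤ) ∈ letterBox undir M := by rw [mem_letterBox]; simp
  have h1 : (1 : ℤ) ∈ letterBox undir M := by rw [mem_letterBox]; simpa using hM
  set φ : (Fin k → ℤ) → (Fin k → G) → G := fun v z => ∏ i, z i ^ v i with hφ
  set K : ℝ := ((2 * M : ℕ) : ℝ) ^ minGen G with hK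
  set E : ℝ := Fintype.card G * Q + (2 * M) * K * (1 - p 0 * p 1) ^ k with hE
  have hcol : ∀ v ∈ P, ∀ w ∈ P,
      (Fintype.card G : ℝ) * tupleProb G k (fun z => φ v z = φ w z) ≤
      1 + (if v = w then (Fintype.card G : ℝ) else 0) +
        ∑ g ∈ Icc 2 (2 * M), K * if ∀ i, (g : ℤ) ∣ v i - w i then 1 else 0 := by
    intro v hv w hw
    have hb : ∀ i, ((v - w) i).natAbs ≤ 2 * M := fun i => by
      have h1 := (mem_letterBox.1 (Fintype.mem_piFinset.1 hv i)).1
      have h2 := (mem_letterBox.1 (Fintype.mem_piFinset.1 hw i)).1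
      simp only [Pi.sub_apply]
      lia
    have h := card_mul_tupleProb_prod_zpow_le_sum (G := G) (v - w) hb
    have e : (fun z : Fin k → G => ∏ i, z i ^ (v - w) i = 1) = fun z => φ v z = φ w z := by
      ext z
      simp only [hφ, Pi.sub_apply, zpow_sub, prod_mul_distrib, prod_inv_distrib,
        mul_inv_eq_one]
    rw [e] at h
    simpa only [sub_eq_zero, Pi.sub_apply] using h
  have hSpos : 0 < S := by linarith
  have hK0 : 0 ≤ K := by positivity
  have hQ0 : 0 ≤ Q := by
    obtain ⟨v, hv⟩ : I.Nonempty := by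
      by_contra h
      rw [not_nonempty_iff_eq_empty] at h
      rw [hSdef, h, sum_empty] at hSpos
      exact lt_irrefl _ hSpos
    exact (hqI v hv).trans (mem_filter.1 hv).2.2
  have hcong : ∀ g : ℕ, 2 ≤ g → ∑ v ∈ I, ∑ w ∈ I,
      (q v * q w * if ∀ i, (g : ℤ) ∣ v i - w i then (1 : ℝ) else 0) ≤ (1 - p 0 * p 1) ^ k := by
    intro g hg
    refine le_trans ?_ (sum_congruent_le (k := k) hp hsum h0 h1 hg)
    have hterm : ∀ v ∈ P, ∀ w ∈ P,
        0 ≤ q v * q w * if ∀ i, (g : ℤ) ∣ v i - w i then (1 : ℝ) else 0 := fun v hv w hw =>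
      mul_nonneg (mul_nonneg (hqP v hv) (hqP w hw)) (by positivity)
    refine (sum_le_sum fun v hv => sum_le_sum_of_subset_of_nonneg (filter_subset _ P)
      fun w hw _ => hterm v (mem_filter.1 hv).1 w hw).trans
      (sum_le_sum_of_subset_of_nonneg (filter_subset _ P)
        fun v hv _ => sum_nonneg fun w hw => hterm v hv w hw)
  have hpow : 0 ≤ (1 - p 0 * p 1) ^ k := by
    refine le_trans ?_ (hcong 2 le_rfl)
    exact sum_nonneg fun v hv => sum_nonneg fun w hw =>
      mul_nonneg (mul_nonneg (hqI v hv) (hqI w hw)) (by positivity)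
  have hmain : (Fintype.card G : ℝ) * ∑ v ∈ I, ∑ w ∈ I,
      q v * q w * tupleProb G k (fun z => φ v z = φ w z) ≤ S ^ 2 + E := by
    calc _ = ∑ v ∈ I, ∑ w ∈ I, q v * q w *
          ((Fintype.card G : ℝ) * tupleProb G k (fun z => φ v z = φ w z)) := by
          simp only [mul_sum]
          refine sum_congr rfl fun v _ => sum_congr rfl fun w _ => by ring
      _ ≤ ∑ v ∈ I, ∑ w ∈ I, q v * q w * (1 + (if v = w then (Fintype.card G : ℝ) else 0) +
            ∑ g ∈ Icc 2 (2 * M), K * if ∀ i, (g : ℤ) ∣ v i - w i then 1 else 0) := by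
          refine sum_le_sum fun v hv => sum_le_sum fun w hw => ?_
          exact mul_le_mul_of_nonneg_left (hcol v (mem_filter.1 hv).1 w (mem_filter.1 hw).1)
            (mul_nonneg (hqI v hv) (hqI w hw))
      _ = S ^ 2 + Fintype.card G * ∑ v ∈ I, q v * q v +
            ∑ g ∈ Icc 2 (2 * M), K * ∑ v ∈ I, ∑ w ∈ I,
              (q v * q w * if ∀ i, (g : ℤ) ∣ v i - w i then 1 else 0) := by
          simp only [mul_add, sum_add_distrib, mul_one]
          congr 1
          · congr 1
            · rw [sq, hSdef, sum_mul_sum]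
            · rw [mul_sum]
              refine sum_congr rfl fun v hv => ?_
              simp only [mul_ite, mul_zero, sum_ite_eq, hv, if_true]
              ring
          · simp only [mul_sum]
            rw [sum_congr rfl fun v _ => sum_comm, sum_comm]
            refine sum_congr rfl fun g _ => sum_congr rfl fun v _ => sum_congr rfl fun w _ => ?_
            ring
      _ ≤ _ := by
          rw [hE, ← add_assoc]
          gcongr
          · calc ∑ v ∈ I, q v * q v ≤ ∑ v ∈ I, q v * Q := by
                  refine sum_le_sum fun v hv => ?_
                  exact mul_le_mul_of_nonneg_left (mem_filter.1 hv).2.2 (hqI v hv)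
              _ = S * Q := by rw [sum_mul]
              _ ≤ Q := mul_le_of_le_one_left hQ0 hS1
          · refine (sum_le_sum fun g hg => mul_le_mul_of_nonneg_left
              (hcong g (mem_Icc.1 hg).1) hK0).trans ?_
            rw [sum_const, nsmul_eq_mul, mul_assoc (2 * (M : ℝ))]
            refine mul_le_mul_of_nonneg_right ?_ (mul_nonneg hK0 hpow)
            rw [Nat.card_Icc]
            exact_mod_cast (by lia : 2 * M + 1 - 2 ≤ 2 * M)
  have hS2 : 1 / 4 ≤ S ^ 2 := by nlinarith
  have hE0 : 0 ≤ E := by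
    have : 0 ≤ (2 * (M : ℝ)) * K * (1 - p 0 * p 1) ^ k := by positivity
    have : 0 ≤ (Fintype.card G : ℝ) * Q := by positivity
    linarith
  refine (tupleProb_mono fun z hz => ?_).trans
    ((tupleProb_card_image_lt (η := E / S ^ 2) I q hqI φ hδ hSpos ?_).trans ?_)
  · refine lt_of_le_of_lt ?_ hz
    exact_mod_cast card_le_cayBallCard fun x hx => by
      obtain ⟨v, hv, rfl⟩ := mem_image.1 hx
      obtain ⟨hvP, hvr, -⟩ := mem_filter.1 hv
      exact reach_prod_zpow z v
        (fun h i => (mem_letterBox.1 (Fintype.mem_piFinset.1 hvP i)).2 h) hvr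
  · refine hmain.trans (le_of_eq ?_)
    change S ^ 2 + E = S ^ 2 * (1 + E / S ^ 2)
    field_simp
  · gcongr
    rw [div_le_iff₀ (by positivity)]
    nlinarith

end RandomExponents

section LargeDeviations

theorem exists_chernoff_bound {s : Finset ℤ} {p : ℤ → ℝ} (hp : ∀ j ∈ s, 0 ≤ p j)
    (hsum : ∑ j ∈ s, p j = 1) (f : ℤ → ℝ) {a : ℝ} (ha : ∑ j ∈ s, p j * f j < a) :
    ∃ ρ : ℝ, 0 ≤ ρ ∧ ρ < 1 ∧ ∀ k : ℕ,
      ∑ v ∈ (Fintype.piFinset fun _ : Fin k => s).filter (fun v => k * a < ∑ i, f (v i)),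
        ∏ i, p (v i) ≤ ρ ^ k := by
  set ψ : ℝ → ℝ := fun θ => ∑ j ∈ s, p j * Real.exp (θ * (f j - a)) with hψ
  have hd : HasDerivAt ψ (∑ j ∈ s, p j * (f j - a)) 0 := by
    have : ∀ j ∈ s, HasDerivAt (fun θ : ℝ => p j * Real.exp (θ * (f j - a)))
        (p j * (f j - a)) 0 := by
      intro j _
      have h1 : HasDerivAt (fun θ : ℝ => θ * (f j - a)) (f j - a) 0 := by
        simpa using (hasDerivAt_id (0 : ℝ)).mul_const (f j - a)
      simpa using h1.exp.const_mul (p j)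
    exact HasDerivAt.fun_sum this
  have hneg : ∑ j ∈ s, p j * (f j - a) < 0 := by
    simp only [mul_sub, sum_sub_distrib, ← sum_mul, hsum]
    linarith
  have hψ0 : ψ 0 = 1 := by simp [hψ, hsum]
  obtain ⟨θ, hθ, hθ0⟩ := ((hd.tendsto_slope_zero_right.eventually_lt_const hneg).and
    self_mem_nhdsWithin).exists
  have hθ0 : 0 < θ := hθ0
  have hlt : ψ θ < 1 := by
    rw [zero_add, hψ0, smul_eq_mul] at hθ
    have := (mul_neg_iff.1 hθ).resolve_right fun h => absurd h.1 (by simp [hθ0.le])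
    linarith [this.2]
  have hψnn : 0 ≤ ψ θ := sum_nonneg fun j hj => mul_nonneg (hp j hj) (Real.exp_nonneg _)
  refine ⟨ψ θ, hψnn, hlt, fun k => ?_⟩
  have hnn : ∀ v ∈ Fintype.piFinset fun _ : Fin k => s,
      0 ≤ ∏ i, p (v i) * Real.exp (θ * (f (v i) - a)) := fun v hv =>
    prod_nonneg fun i _ => mul_nonneg (hp _ (Fintype.mem_piFinset.1 hv i)) (Real.exp_nonneg _)
  rw [← sum_piFinset_prod s fun j => p j * Real.exp (θ * (f j - a))]
  refine le_trans (sum_le_sum fun v hv => ?_)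
    (sum_le_sum_of_subset_of_nonneg (filter_subset _ _) fun v hv _ => hnn v hv)
  obtain ⟨hv, hlarge⟩ := mem_filter.1 hv
  rw [prod_mul_distrib, ← Real.exp_sum, ← mul_sum, sum_sub_distrib]
  refine le_mul_of_one_le_right (prod_nonneg fun i _ => hp _ (Fintype.mem_piFinset.1 hv i)) ?_
  rw [Real.one_le_exp_iff]
  refine mul_nonneg hθ0.le ?_
  simp only [sum_const, card_univ, Fintype.card_fin, nsmul_eq_mul]
  linarith

end LargeDeviations

section Entropy

/-- Mean absolute value of a geometric letter with parameter `t`. -/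
noncomputable def letterMean (undir : Bool) (t : ℝ) : ℝ :=
  letterMoment undir t / letterGF undir t

/-- Entropy of a geometric letter with parameter `t`. -/
noncomputable def letterEntropy (undir : Bool) (t : ℝ) : ℝ :=
  Real.log (letterGF undir t) + letterMean undir t * Real.log t⁻¹

theorem letterMean_eq {undir : Bool} {t : ℝ} (h0 : 0 ≤ t) (h1 : t < 1) :
    letterMean undir t = (if undir then 2 / ((1 - t) * (1 + t)) else 1 / (1 - t)) * t := by
  have h2 : 1 - t ≠ 0 := by linarith
  have h3 : 1 + t ≠ 0 := by linarith
  cases undir <;> simp [letterMean, letterMoment, letterGF] <;> field_simp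

theorem letterMean_pos {undir : Bool} {t : ℝ} (h0 : 0 < t) (h1 : t < 1) :
    0 < letterMean undir t := by
  have h2 : 0 < 1 - t := by linarith
  rw [letterMean_eq h0.le h1]
  split_ifs <;> positivity

theorem continuousOn_letterMean (undir : Bool) :
    ContinuousOn (letterMean undir) (Set.Ico 0 1) := by
  have h : ∀ t ∈ Set.Ico (0 : ℝ) 1, letterMean undir t =
      (if undir then 2 / ((1 - t) * (1 + t)) else 1 / (1 - t)) * t := fun t ht =>
    letterMean_eq ht.1 ht.2
  refine ContinuousOn.congr ?_ h
  cases undir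
  · simp only [Bool.false_eq_true, if_false]
    refine (continuousOn_const.div (by fun_prop) fun t ht => ?_).mul continuousOn_id
    linarith [ht.2]
  · simp only [if_true]
    refine (continuousOn_const.div (by fun_prop) fun t ht => ?_).mul continuousOn_id
    have h1 : 0 < 1 - t := by linarith [ht.2]
    have h2 : 0 < 1 + t := by linarith [ht.1]
    positivity

theorem continuousOn_letterGF (undir : Bool) :
    ContinuousOn (letterGF undir) (Set.Ico 0 1) := by
  refine ContinuousOn.div ?_ (by fun_prop) fun t ht => by linarith [ht.2]
  cases undir
  · simp only [Bool.false_eq_true, if_false]; fun_prop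
  · simp only [if_true]; fun_prop

theorem continuousOn_letterEntropy (undir : Bool) :
    ContinuousOn (letterEntropy undir) (Set.Ico 0 1) := by
  have h : ∀ t ∈ Set.Ico (0 : ℝ) 1, letterEntropy undir t = Real.log (letterGF undir t) +
      (if undir then 2 / ((1 - t) * (1 + t)) else 1 / (1 - t)) * Real.negMulLog t := by
    intro t ht
    rw [letterEntropy, letterMean_eq ht.1 ht.2, Real.negMulLog, Real.log_inv]
    ring
  refine ContinuousOn.congr ?_ h
  refine ContinuousOn.add ?_ (ContinuousOn.mul ?_ Real.continuous_negMulLog.continuousOn)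
  · refine (continuousOn_letterGF undir).log fun t ht => ?_
    have := one_le_letterGF (undir := undir) ht.1 ht.2
    positivity
  · cases undir
    · simp only [Bool.false_eq_true, if_false]
      refine continuousOn_const.div (by fun_prop) fun t ht => ?_
      linarith [ht.2]
    · simp only [if_true]
      refine continuousOn_const.div (by fun_prop) fun t ht => ?_
      have h1 : 0 < 1 - t := by linarith [ht.2]
      have h2 : 0 < 1 + t := by linarith [ht.1]
      positivity

theorem letterEntropy_zero (undir : Bool) : letterEntropy undir 0 = 0 := by
  cases undir <;> simp [letterEntropy, letterGF]

theorem neg_log_one_sub_le_letterEntropy {undir : Bool} {t : ℝ} (h0 : 0 < t) (h1 : t < 1) :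
    -Real.log (1 - t) ≤ letterEntropy undir t := by
  have h2 : 0 < 1 - t := by linarith
  have hm := letterMean_pos (undir := undir) h0 h1
  have hl : 0 ≤ Real.log t⁻¹ := Real.log_nonneg ((one_le_inv₀ h0).2 h1.le)
  have hg : -Real.log (1 - t) ≤ Real.log (letterGF undir t) := by
    rw [← Real.log_inv]
    refine Real.log_le_log (by positivity) ?_
    rw [letterGF, inv_eq_one_div]
    gcongr
    split_ifs <;> linarith
  have := mul_nonneg hm.le hl
  rw [letterEntropy]
  linarith

/-- The critical exponent at entropy `c`: the volume bound is attained at a parameter `t` where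
the letter entropy equals `c`, and slightly longer letters have strictly larger entropy. -/
theorem exists_critical_exponent (undir : Bool) {c : ℝ} (hc : 0 < c) :
    ∃ α : ℝ, 0 < α ∧
      (∃ t : ℝ, 0 < t ∧ t < 1 ∧ c = Real.log (letterGF undir t) + α * Real.log t⁻¹) ∧
      ∀ A : ℝ, α < A → ∃ s : ℝ, 0 < s ∧ s < 1 ∧ letterMean undir s < A ∧
        c < letterEntropy undir s := by
  set b : ℝ := 1 - Real.exp (-(c + 1)) with hb
  have hb1 : b < 1 := by have := Real.exp_pos (-(c + 1)); linarith
  have hb0 : 0 < b := by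
    have : Real.exp (-(c + 1)) < 1 := Real.exp_lt_one_iff.2 (by linarith)
    linarith
  have hIcc : Set.Icc 0 b ⊆ Set.Ico (0 : ℝ) 1 := fun t ht => ⟨ht.1, ht.2.trans_lt hb1⟩
  have hcont : ContinuousOn (letterEntropy undir) (Set.Icc 0 b) :=
    (continuousOn_letterEntropy undir).mono hIcc
  have hentb : c < letterEntropy undir b := by
    have := neg_log_one_sub_le_letterEntropy (undir := undir) hb0 hb1
    have h2 : 1 - b = Real.exp (-(c + 1)) := by rw [hb]; ring
    rw [h2, Real.log_exp] at this
    linarith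
  set T : Set ℝ := Set.Icc 0 b ∩ letterEntropy undir ⁻¹' Set.Iic c with hT
  have hTc : IsClosed T := hcont.preimage_isClosed_of_isClosed isClosed_Icc isClosed_Iic
  have hTcomp : IsCompact T := isCompact_Icc.of_isClosed_subset hTc Set.inter_subset_left
  have hTne : T.Nonempty := ⟨0, ⟨le_rfl, hb0.le⟩, by
    rw [Set.mem_preimage, letterEntropy_zero]; exact hc.le⟩
  obtain ⟨t, ⟨⟨ht0, htb⟩, htc⟩, hmax⟩ := hTcomp.exists_isGreatest hTne
  have htc : letterEntropy undir t ≤ c := htc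
  have htb' : t < b := lt_of_le_of_ne htb fun h => by rw [h] at htc; linarith
  have hgt : ∀ u, t < u → u ≤ b → c < letterEntropy undir u := by
    intro u hu hub
    by_contra h
    exact absurd (hmax ⟨⟨ht0.trans hu.le, hub⟩, not_lt.1 h⟩) (not_le.2 hu)
  have hnhds : Set.Ico (0 : ℝ) 1 ∈ nhdsWithin t (Set.Ioi t) :=
    Filter.mem_of_superset (Ioo_mem_nhdsGT (htb'.trans hb1)) fun u hu =>
      ⟨ht0.trans hu.1.le, hu.2⟩
  have htlim : Tendsto (letterEntropy undir) (nhdsWithin t (Set.Ioi t))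
      (nhds (letterEntropy undir t)) :=
    ((continuousOn_letterEntropy undir) t ⟨ht0, htb'.trans hb1⟩).mono_left
      (nhdsWithin_le_iff.2 hnhds)
  have hmlim : Tendsto (letterMean undir) (nhdsWithin t (Set.Ioi t))
      (nhds (letterMean undir t)) :=
    ((continuousOn_letterMean undir) t ⟨ht0, htb'.trans hb1⟩).mono_left
      (nhdsWithin_le_iff.2 hnhds)
  have hev : ∀ᶠ u in nhdsWithin t (Set.Ioi t), t < u ∧ u ≤ b :=
    Filter.mem_of_superset (Ioo_mem_nhdsGT htb') fun u hu => ⟨hu.1, hu.2.le⟩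
  have hteq : letterEntropy undir t = c :=
    le_antisymm htc (ge_of_tendsto htlim (hev.mono fun u hu => (hgt u hu.1 hu.2).le))
  have htpos : 0 < t := lt_of_le_of_ne ht0 fun h => by
    rw [← h, letterEntropy_zero] at hteq; linarith
  refine ⟨letterMean undir t, letterMean_pos htpos (htb'.trans hb1),
    ⟨t, htpos, htb'.trans hb1, hteq.symm⟩, fun A hA => ?_⟩
  obtain ⟨u, hu1, hu2⟩ := ((hmlim.eventually_lt_const hA).and hev).exists
  exact ⟨u, ht0.trans_lt hu2.1, hu2.2.trans_lt hb1, hu1, hgt u hu2.1 hu2.2⟩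

/-- Truncated geometric letters realise any volume exponent `h` below the entropy. -/
theorem exists_tupleProb_card_ball_lt_le (undir : Bool) {s A h : ℝ} (hs0 : 0 < s) (hs1 : s < 1)
    (hA : letterMean undir s < A) (hh : h < letterEntropy undir s) :
    ∃ (ρ : ℝ) (K : ℕ), 0 ≤ ρ ∧ ρ < 1 ∧ 0 < K ∧ ∀ᶠ k : ℕ in atTop,
      ∀ (G : Type) [CommGroup G] [Fintype G] (r : ℕ) (δ : ℝ), k * A ≤ r → 0 < δ →
        tupleProb G k (fun z => (cayBallCard undir z r : ℝ) < (1 - δ) * Fintype.card G) ≤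
          4 * (Fintype.card G * Real.exp (-(k * h)) + K * (K : ℝ) ^ minGen G * ρ ^ k) / δ := by
  have hGF := one_le_letterGF (undir := undir) hs0.le hs1
  have hF := tendsto_letterGF (undir := undir) hs0.le hs1
  have hmean : Tendsto (fun M => (∑ j ∈ letterBox undir M, (j.natAbs : ℝ) * s ^ j.natAbs) /
      ∑ j ∈ letterBox undir M, s ^ j.natAbs) atTop (nhds (letterMean undir s)) :=
    (tendsto_letterMoment hs0.le hs1).div hF (by positivity)
  have hent := (hF.log (by positivity)).add (hmean.mul_const (Real.log s⁻¹))
  obtain ⟨M, ⟨hMA, hMh⟩, hM⟩ := (((hmean.eventually_lt_const hA).and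
    (hent.eventually_const_lt hh)).and (eventually_ge_atTop 1)).exists
  set S := letterBox undir M with hS
  set F : ℝ := ∑ j ∈ S, s ^ j.natAbs with hFdef
  have h0mem : (0 : ℤ) ∈ S := by simp [hS, mem_letterBox]
  have h1mem : (1 : ℤ) ∈ S := by simp [hS, mem_letterBox, hM]
  have hFpos : 0 < F := sum_pos (fun j _ => by positivity) ⟨0, h0mem⟩
  set p : ℤ → ℝ := fun j => s ^ j.natAbs / F with hp
  have hppos : ∀ j, 0 < p j := fun j => by positivity
  have hpsum : ∑ j ∈ S, p j = 1 := by
    rw [hp, ← sum_div, div_self hFpos.ne']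
  have hple : ∀ j ∈ S, p j ≤ 1 := fun j hj => by
    rw [← hpsum]
    exact single_le_sum (f := p) (fun i _ => (hppos i).le) hj
  have hm : ∑ j ∈ S, p j * (j.natAbs : ℝ) =
      (∑ j ∈ S, (j.natAbs : ℝ) * s ^ j.natAbs) / F := by
    rw [sum_div]
    exact sum_congr rfl fun j _ => by simp only [hp]; ring
  have hlogp : ∀ j, Real.log (p j) = -((j.natAbs : ℝ) * Real.log s⁻¹) - Real.log F := fun j => by
    simp only [hp]
    rw [Real.log_div (by positivity) hFpos.ne', Real.log_pow, Real.log_inv]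
    ring
  have he : ∑ j ∈ S, p j * Real.log (p j) < -h := by
    have : ∑ j ∈ S, p j * Real.log (p j) =
        -((∑ j ∈ S, p j * (j.natAbs : ℝ)) * Real.log s⁻¹) - (∑ j ∈ S, p j) * Real.log F := by
      rw [sum_mul, sum_mul, ← sum_neg_distrib, ← sum_sub_distrib]
      exact sum_congr rfl fun j _ => by rw [hlogp]; ring
    rw [this, hm, hpsum]
    linarith
  obtain ⟨ρ₁, hρ₁, hρ₁', hc₁⟩ := exists_chernoff_bound (fun j _ => (hppos j).le) hpsum
    (fun j => (j.natAbs : ℝ)) (hm.trans_lt hMA)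
  obtain ⟨ρ₂, hρ₂, hρ₂', hc₂⟩ := exists_chernoff_bound (fun j _ => (hppos j).le) hpsum
    (fun j => Real.log (p j)) he
  have hp01 : 0 < p 0 * p 1 := mul_pos (hppos 0) (hppos 1)
  have hp01' : p 0 * p 1 ≤ 1 := mul_le_one₀ (hple 0 h0mem) (hppos 1).le (hple 1 h1mem)
  refine ⟨1 - p 0 * p 1, 2 * M, by linarith, by linarith, by omega, ?_⟩
  filter_upwards [(tendsto_pow_atTop_nhds_zero_of_lt_one hρ₁ hρ₁').eventually_le_const
      (show (0 : ℝ) < 1 / 4 by norm_num),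
    (tendsto_pow_atTop_nhds_zero_of_lt_one hρ₂ hρ₂').eventually_le_const
      (show (0 : ℝ) < 1 / 4 by norm_num)] with k hk₁ hk₂
  intro G _ _ r δ hr hδ
  have hgood : (1 / 2 : ℝ) ≤ ∑ v ∈ (Fintype.piFinset fun _ : Fin k => S).filter
      (fun v => ∑ i, (v i).natAbs ≤ r ∧ ∏ i, p (v i) ≤ Real.exp (-(k * h))), ∏ i, p (v i) := by
    have htot : ∑ v ∈ Fintype.piFinset fun _ : Fin k => S, ∏ i, p (v i) = 1 := by
      rw [sum_piFinset_prod, hpsum, one_pow]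
    have hnn : ∀ v : Fin k → ℤ, 0 ≤ ∏ i, p (v i) := fun v =>
      prod_nonneg fun i _ => (hppos _).le
    rw [← sum_filter_add_sum_filter_not _
      (fun v : Fin k → ℤ => ∑ i, (v i).natAbs ≤ r ∧ ∏ i, p (v i) ≤ Real.exp (-(k * h)))] at htot
    have hbad := sum_le_sum_of_subset_of_nonneg (f := fun v : Fin k → ℤ => ∏ i, p (v i))
      (s := (Fintype.piFinset fun _ : Fin k => S).filter
        (fun v => ¬ (∑ i, (v i).natAbs ≤ r ∧ ∏ i, p (v i) ≤ Real.exp (-(k * h)))))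
      (t := (Fintype.piFinset fun _ : Fin k => S).filter
          (fun v => k * A < ∑ i, ((v i).natAbs : ℝ)) ∪
        (Fintype.piFinset fun _ : Fin k => S).filter
          (fun v => k * (-h) < ∑ i, Real.log (p (v i)))) ?_ fun v _ _ => hnn v
    · have hun := sum_union_inter (f := fun v : Fin k → ℤ => ∏ i, p (v i))
        (s₁ := (Fintype.piFinset fun _ : Fin k => S).filter
          (fun v => k * A < ∑ i, ((v i).natAbs : ℝ)))
        (s₂ := (Fintype.piFinset fun _ : Fin k => S).filter
          (fun v => k * (-h) < ∑ i, Real.log (p (v i))))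
      have hin := sum_nonneg (s := (Fintype.piFinset fun _ : Fin k => S).filter
          (fun v => k * A < ∑ i, ((v i).natAbs : ℝ)) ∩
        (Fintype.piFinset fun _ : Fin k => S).filter
          (fun v => k * (-h) < ∑ i, Real.log (p (v i)))) fun v _ => hnn v
      have h1 := hc₁ k
      have h2 := hc₂ k
      linarith
    · intro v hv
      rw [mem_filter] at hv
      rw [mem_union, mem_filter, mem_filter]
      by_contra hcon
      push Not at hcon
      have h1 := hcon.1 hv.1
      have h2 := hcon.2 hv.1
      refine hv.2 ⟨?_, ?_⟩
      · have := h1.trans hr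
        exact_mod_cast this
      · rw [← Real.log_le_iff_le_exp (prod_pos fun i _ => hppos _),
          Real.log_prod fun i _ => (hppos _).ne']
        linarith
  have := tupleProb_card_ball_lt_of_letters (G := G) (k := k) undir hM (fun j _ => (hppos j).le)
    hpsum hδ hgood
  refine this.trans (le_of_eq ?_)
  push_cast
  ring

end Entropy

section LinearRegime

variable {G : ℕ → Type} {k : ℕ → ℕ}

theorem eventually_critical_mul_le_radius [∀ N, CommGroup (G N)] [∀ N, Fintype (G N)]
    {undir : Bool} {c α t : ℝ} (hα : 0 < α) (ht0 : 0 < t) (ht1 : t < 1)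
    (hc : c = Real.log (letterGF undir t) + α * Real.log t⁻¹) (hk : ∀ N, 0 < k N)
    {w : ℕ → ℝ} (hw : ∀ N, 0 < w N)
    (hlim : Tendsto (fun N => Real.log (w N) / k N) atTop (nhds c)) {ε : ℝ} (hε : 0 < ε) :
    ∀ᶠ N in atTop, ∀ (z : Fin (k N) → G N) (r : ℕ), w N ≤ cayBallCard undir z r →
      (1 - ε) * (α * k N) ≤ r := by
  have hl : 0 < Real.log t⁻¹ := Real.log_pos ((one_lt_inv₀ ht0).2 ht1)
  have hlt : Real.log (letterGF undir t) + (1 - ε) * α * Real.log t⁻¹ < c := by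
    have := mul_pos (mul_pos hε hα) hl
    linarith
  filter_upwards [hlim.eventually_const_lt hlt] with N hN z r hr
  have hkN : (0 : ℝ) < k N := by exact_mod_cast hk N
  rw [lt_div_iff₀ hkN] at hN
  have := log_cayBallCard_le z ht0 ht1 r (hw N) hr
  refine le_of_mul_le_mul_right ?_ hl
  linarith

theorem tendsto_tupleProb_card_ball_lt [∀ N, CommGroup (G N)] [∀ N, Fintype (G N)]
    {undir : Bool} {s A h h' δ : ℝ} (hs0 : 0 < s) (hs1 : s < 1) (hA : letterMean undir s < A)
    (hh : h < letterEntropy undir s) (hh' : h' < h) (hδ : 0 < δ) (hk : Tendsto k atTop atTop)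
    (hlog : ∀ᶠ N in atTop, Real.log (Fintype.card (G N)) ≤ k N * h')
    (hmin : Tendsto (fun N => (minGen (G N) : ℝ) / k N) atTop (nhds 0))
    {r : ℕ → ℕ} (hr : ∀ᶠ N in atTop, k N * A ≤ r N) :
    Tendsto (fun N => tupleProb (G N) (k N) fun z =>
      (cayBallCard undir z (r N) : ℝ) < (1 - δ) * Fintype.card (G N)) atTop (nhds 0) := by
  obtain ⟨ρ, K, hρ0, hρ1, hK, hev⟩ := exists_tupleProb_card_ball_lt_le undir hs0 hs1 hA hh
  have hkR : Tendsto (fun N => (k N : ℝ)) atTop atTop := tendsto_natCast_atTop_atTop.comp hk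
  set σ : ℝ := max ρ (1 / 2) with hσ
  have hσ0 : 0 < σ := lt_max_of_lt_right (by norm_num)
  have hσ1 : σ < 1 := max_lt hρ1 (by norm_num)
  have hKR : (0 : ℝ) < K := by exact_mod_cast hK
  have hE1 : Tendsto (fun N => Real.exp (-((h - h') * k N))) atTop (nhds 0) :=
    Real.tendsto_exp_neg_atTop_nhds_zero.comp (hkR.const_mul_atTop (by linarith))
  have hE2 : Tendsto (fun N => Real.exp
      ((minGen (G N) / k N * Real.log K + Real.log σ) * k N)) atTop (nhds 0) := by
    refine Real.tendsto_exp_atBot.comp (Tendsto.neg_mul_atTop (Real.log_neg hσ0 hσ1) ?_ hkR)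
    simpa using (hmin.mul_const (Real.log K)).add_const (Real.log σ)
  have hub : Tendsto (fun N => 4 * (Real.exp (-((h - h') * k N)) + K * Real.exp
      ((minGen (G N) / k N * Real.log K + Real.log σ) * k N)) / δ) atTop (nhds 0) := by
    simpa using ((hE1.add (hE2.const_mul (K : ℝ))).const_mul 4).div_const δ
  refine squeeze_zero' (Eventually.of_forall fun N => tupleProb_nonneg _) ?_ hub
  filter_upwards [hk.eventually hev, hlog, hr, hkR.eventually_gt_atTop 0] with N h1 h2 h3 h4
  refine (h1 (G N) (r N) δ h3 hδ).trans ?_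
  have hn : (0 : ℝ) < Fintype.card (G N) := by exact_mod_cast Fintype.card_pos
  have e1 : Fintype.card (G N) * Real.exp (-(k N * h)) ≤ Real.exp (-((h - h') * k N)) := by
    rw [← Real.exp_log hn, ← Real.exp_add, Real.exp_le_exp]
    linarith
  have e2 : (K : ℝ) ^ minGen (G N) * ρ ^ k N ≤
      Real.exp ((minGen (G N) / k N * Real.log K + Real.log σ) * k N) := by
    have : (minGen (G N) / k N * Real.log K + Real.log σ) * k N =
        minGen (G N) * Real.log K + k N * Real.log σ := by field_simp
    rw [this, Real.exp_add, Real.exp_nat_mul, Real.exp_nat_mul, Real.exp_log hKR,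
      Real.exp_log hσ0]
    gcongr
    exact le_max_left _ _
  rw [mul_assoc]
  gcongr

theorem tendsto_tupleProb_not_reach [∀ N, CommGroup (G N)] [∀ N, Fintype (G N)]
    {undir : Bool} {s A c : ℝ} (hc : 0 < c) (hs0 : 0 < s) (hs1 : s < 1)
    (hA : letterMean undir s < A) (hh : c < letterEntropy undir s) (hk : Tendsto k atTop atTop)
    (hlim : Tendsto (fun N => Real.log (Fintype.card (G N)) / k N) atTop (nhds c))
    (hmin : Tendsto (fun N => (minGen (G N) : ℝ) / k N) atTop (nhds 0))
    {r : ℕ → ℕ} (hr : ∀ᶠ N in atTop, k N * A ≤ r N) :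
    Tendsto (fun N => tupleProb (G N) (k N) fun z => ¬ ∀ x, Reach undir z (r N + 1) x)
      atTop (nhds 0) := by
  have hA0 : 0 < A := (letterMean_pos hs0 hs1).trans hA
  obtain ⟨h, hch, hhe⟩ := exists_between hh
  obtain ⟨h', hch', hh'⟩ := exists_between hch
  obtain ⟨g, hcg, hg⟩ := exists_between hch'
  have hg0 : 0 < g := hc.trans hcg
  have hh'0 : 0 < h' := hg0.trans hg
  set η : ℝ := 1 - g / h' with hη
  have hη0 : 0 < η := by rw [hη, sub_pos, div_lt_one hh'0]; exact hg
  have hη1 : η < 1 := by have := div_pos hg0 hh'0; linarith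
  have hkR : Tendsto (fun N => (k N : ℝ)) atTop atTop := tendsto_natCast_atTop_atTop.comp hk
  set b : ℕ → ℕ := fun N => ⌊η * k N⌋₊ with hb
  have hble : ∀ N, (b N : ℝ) ≤ η * k N := fun N => Nat.floor_le (by positivity)
  have hblek : ∀ N, b N ≤ k N := fun N => by
    have h1 : η * k N ≤ k N := mul_le_of_le_one_left (by positivity) hη1.le
    exact_mod_cast (hble N).trans h1
  set a : ℕ → ℕ := fun N => k N - b N with ha
  have hab : ∀ N, k N = a N + b N := fun N => (Nat.sub_add_cancel (hblek N)).symm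
  have habR : ∀ N, (k N : ℝ) = a N + b N := fun N => by exact_mod_cast hab N
  have hage : ∀ N, g / h' * k N ≤ a N := fun N => by
    have h1 := habR N
    have h2 := hble N
    rw [hη] at h2
    linarith
  have hgh : 0 < g / h' := div_pos hg0 hh'0
  have haR : Tendsto (fun N => (a N : ℝ)) atTop atTop :=
    tendsto_atTop_mono hage (hkR.const_mul_atTop hgh)
  have hat : Tendsto a atTop atTop := tendsto_natCast_atTop_iff.1 haR
  have hlog : ∀ᶠ N in atTop, Real.log (Fintype.card (G N)) ≤ a N * h' := by
    filter_upwards [hlim.eventually_lt_const hcg, hkR.eventually_gt_atTop 0] with N h1 h2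
    rw [div_lt_iff₀ h2] at h1
    have h3 := mul_le_mul_of_nonneg_right (hage N) hh'0.le
    have h4 : g / h' * k N * h' = g * k N := by field_simp
    linarith
  have hmina : Tendsto (fun N => (minGen (G N) : ℝ) / a N) atTop (nhds 0) := by
    have hup : Tendsto (fun N => (minGen (G N) : ℝ) / k N / (g / h')) atTop (nhds 0) := by
      simpa using hmin.div_const (g / h')
    refine squeeze_zero' (Eventually.of_forall fun N => by positivity) ?_ hup
    filter_upwards [hkR.eventually_gt_atTop 0] with N h1
    rw [div_div]
    have := hage N
    gcongr
    linarith
  have hra : ∀ᶠ N in atTop, a N * A ≤ r N := by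
    filter_upwards [hr] with N h1
    refine le_trans ?_ h1
    have : (a N : ℝ) ≤ k N := by rw [habR N]; simp
    gcongr
  set δ : ℝ := Real.exp (-((2 * c + 2) / η)) with hδ
  have hδ0 : 0 < δ := Real.exp_pos _
  have h1 := tendsto_tupleProb_card_ball_lt hs0 hs1 hA hhe hh' hδ0 hat hlog hmina hra
  have h2 : Tendsto (fun N => Real.exp (-((c + 1) * k N + -((2 * c + 2) / η)))) atTop
      (nhds 0) :=
    Real.tendsto_exp_neg_atTop_nhds_zero.comp
      (tendsto_atTop_add_const_right _ _ (hkR.const_mul_atTop (by linarith)))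
  have h3 := h1.add h2
  rw [add_zero] at h3
  refine squeeze_zero' (Eventually.of_forall fun N => tupleProb_nonneg _) ?_ h3
  filter_upwards [hlim.eventually_lt_const (lt_add_one c), hkR.eventually_gt_atTop 0]
    with N h4 h5
  refine (tupleProb_not_reach_le undir (hab N) (r N) hδ0.le).trans ?_
  gcongr
  have hn : (0 : ℝ) < Fintype.card (G N) := by exact_mod_cast Fintype.card_pos
  rw [div_lt_iff₀ h5] at h4
  rw [hδ, ← Real.exp_nat_mul, ← Real.exp_log hn, ← Real.exp_add,
    Real.exp_le_exp]
  have h6 : η * k N < b N + 1 := Nat.lt_floor_add_one _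
  have h7 : 0 < (2 * c + 2) / η := by positivity
  have h8 := mul_lt_mul_of_pos_right h6 h7
  have h9 : η * k N * ((2 * c + 2) / η) = (2 * c + 2) * k N := by field_simp
  rw [h9] at h8
  linarith

end LinearRegime

section LinearRegimeLimits

variable {G : ℕ → Type} {k : ℕ → ℕ}

theorem tendsto_tupleProb_zero_of_eventually_imp [∀ N, Fintype (G N)]
    {p q : ∀ N, (Fin (k N) → G N) → Prop}
    (hq : Tendsto (fun N => tupleProb (G N) (k N) (q N)) atTop (nhds 0))
    (h : ∀ᶠ N in atTop, ∀ z, p N z → q N z) :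
    Tendsto (fun N => tupleProb (G N) (k N) (p N)) atTop (nhds 0) :=
  squeeze_zero' (Eventually.of_forall fun _ => tupleProb_nonneg _)
    (h.mono fun _ hN => tupleProb_mono hN) hq

theorem tendsto_log_card_div [∀ N, Fintype (G N)] {lambda : ℝ} (hl : 0 < lambda)
    (hlim : Tendsto (fun N => (k N : ℝ) / Real.log (Fintype.card (G N))) atTop (nhds lambda)) :
    Tendsto (fun N => Real.log (Fintype.card (G N)) / k N) atTop (nhds lambda⁻¹) := by
  simpa only [inv_div] using hlim.inv₀ hl.ne'

theorem tendsto_minGen_div [∀ N, CommGroup (G N)] [∀ N, Fintype (G N)] {c : ℝ} (hc : 0 < c)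
    (hk : Tendsto k atTop atTop)
    (hlim : Tendsto (fun N => Real.log (Fintype.card (G N)) / k N) atTop (nhds c))
    (hmin : ∀ N, (minGen (G N) : ℝ) ≤
      (1 / 4) * Real.log (Fintype.card (G N)) / Real.log (Real.log (Fintype.card (G N)))) :
    Tendsto (fun N => (minGen (G N) : ℝ) / k N) atTop (nhds 0) := by
  have hkR : Tendsto (fun N => (k N : ℝ)) atTop atTop := tendsto_natCast_atTop_atTop.comp hk
  have hlog : Tendsto (fun N => Real.log (Fintype.card (G N))) atTop atTop := by
    refine (hlim.pos_mul_atTop hc hkR).congr' ?_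
    filter_upwards [hkR.eventually_gt_atTop 0] with N hN
    field_simp
  have hll := Real.tendsto_log_atTop.comp hlog
  have hub : Tendsto (fun N => 1 / 4 * (Real.log (Fintype.card (G N)) / k N) /
      Real.log (Real.log (Fintype.card (G N)))) atTop (nhds 0) :=
    (hlim.const_mul (1 / 4)).div_atTop hll
  refine squeeze_zero (fun N => by positivity) (fun N => ?_) hub
  have := div_le_div_of_nonneg_right (hmin N) (Nat.cast_nonneg (α := ℝ) (k N))
  refine this.trans (le_of_eq ?_)
  ring

theorem le_cayBallCard_typDist {H : Type*} [Group H] [Fintype H] {undir : Bool} {m r : ℕ}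
    {z : Fin m → H} {β : ℝ} (h : β * Fintype.card H ≤ cayBallCard undir z r) :
    typDist undir z β ≤ r ∧ β * Fintype.card H ≤ cayBallCard undir z (typDist undir z β) :=
  ⟨Nat.sInf_le h, Nat.sInf_mem (s := {r : ℕ | β * (Fintype.card H : ℝ) ≤
    (cayBallCard undir z r : ℝ)}) ⟨r, h⟩⟩

theorem abs_div_sub_one_le {x y ε : ℝ} (hy : 0 < y) (h1 : (1 - ε) * y ≤ x)
    (h2 : x ≤ (1 + ε) * y) : |x / y - 1| ≤ ε := by
  have h3 := (le_div_iff₀ hy).2 h1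
  have h4 := (div_le_iff₀ hy).2 h2
  exact abs_le.2 ⟨by linarith, by linarith⟩

theorem tendsto_log_mul_card_div [∀ N, Group (G N)] [∀ N, Fintype (G N)] {c β : ℝ} (hβ : 0 < β)
    (hk : Tendsto k atTop atTop)
    (hlim : Tendsto (fun N => Real.log (Fintype.card (G N)) / k N) atTop (nhds c)) :
    Tendsto (fun N => Real.log (β * Fintype.card (G N)) / k N) atTop (nhds c) := by
  have hkR : Tendsto (fun N => (k N : ℝ)) atTop atTop := tendsto_natCast_atTop_atTop.comp hk
  have := (tendsto_const_nhds (x := Real.log β)).div_atTop hkR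
  have := this.add hlim
  rw [zero_add] at this
  refine this.congr fun N => ?_
  rw [Real.log_mul hβ.ne' (by simp), add_div]

/-- Concentration of the typical distance and of the diameter in the regime `k ≍ log |G|`,
together with the deterministic lower bound on the diameter. -/
theorem exists_linear_regime_constant {lambda : ℝ} (hl : 0 < lambda) (undir : Bool) :
    ∃ α : ℝ, 0 < α ∧
    ((∀ (G : ℕ → Type) [∀ N, CommGroup (G N)] [∀ N, Fintype (G N)] (k : ℕ → ℕ),
      (∀ N, 0 < k N) →
      Tendsto k atTop atTop →
      Tendsto (fun N => (k N : ℝ) / Real.log (Fintype.card (G N))) atTop (nhds lambda) →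
      (∀ N, (minGen (G N) : ℝ) ≤
        (1 / 4) * Real.log (Fintype.card (G N)) / Real.log (Real.log (Fintype.card (G N)))) →
      ∀ ε : ℝ, 0 < ε →
        (∀ β : ℝ, 0 < β → β < 1 →
          Tendsto (fun N => tupleProb (G N) (k N) fun z =>
              ε < |(typDist undir z β : ℝ) / (α * (k N : ℝ)) - 1|)
            atTop (nhds 0)) ∧
        Tendsto (fun N => tupleProb (G N) (k N) fun z =>
            ¬ ∃ D : ℕ, cayDiam undir z = (D : ℕ∞) ∧
              |(D : ℝ) / (α * (k N : ℝ)) - 1| ≤ ε)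
          atTop (nhds 0)) ∧
    (∀ (G : ℕ → Type) [∀ N, CommGroup (G N)] [∀ N, Fintype (G N)] (k : ℕ → ℕ),
      (∀ N, 0 < k N) →
      Tendsto (fun N => (k N : ℝ) / Real.log (Fintype.card (G N))) atTop (nhds lambda) →
      ∀ ε : ℝ, 0 < ε →
        ∀ᶠ N in atTop, ∀ (z : Fin (k N) → G N) (D : ℕ), cayDiam undir z = (D : ℕ∞) →
          (1 - ε) * (α * (k N : ℝ)) ≤ (D : ℝ))) := by
  have hc : 0 < lambda⁻¹ := inv_pos.2 hl
  obtain ⟨α, hα, ⟨t, ht0, ht1, hct⟩, hcrit⟩ := exists_critical_exponent undir hc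
  have hdiam : ∀ (G : ℕ → Type) [∀ N, CommGroup (G N)] [∀ N, Fintype (G N)] (k : ℕ → ℕ),
      (∀ N, 0 < k N) →
      Tendsto (fun N => (k N : ℝ) / Real.log (Fintype.card (G N))) atTop (nhds lambda) →
      ∀ ε : ℝ, 0 < ε →
        ∀ᶠ N in atTop, ∀ (z : Fin (k N) → G N) (D : ℕ), cayDiam undir z = (D : ℕ∞) →
          (1 - ε) * (α * (k N : ℝ)) ≤ (D : ℝ) := by
    intro G _ _ k hk0 hlim ε hε
    filter_upwards [eventually_critical_mul_le_radius (G := G) hα ht0 ht1 hct hk0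
      (fun N => by exact_mod_cast Fintype.card_pos (α := G N)) (tendsto_log_card_div hl hlim) hε]
      with N hN z D hD
    exact hN z D (by rw [cayBallCard_of_cayDiam_eq hD])
  refine ⟨α, hα, ?_, hdiam⟩
  intro G _ _ k hk0 hk hlim hmin ε hε
  have hlim' := tendsto_log_card_div hl hlim
  have hmin' := tendsto_minGen_div hc hk hlim' hmin
  have hkR : Tendsto (fun N => (k N : ℝ)) atTop atTop := tendsto_natCast_atTop_atTop.comp hk
  obtain ⟨s, hs0, hs1, hsA, hsh⟩ := hcrit ((1 + ε / 2) * α) (by nlinarith)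
  set r : ℕ → ℕ := fun N => ⌈(k N : ℝ) * ((1 + ε / 2) * α)⌉₊ with hr
  have hrge : ∀ᶠ N in atTop, (k N : ℝ) * ((1 + ε / 2) * α) ≤ r N :=
    Eventually.of_forall fun N => Nat.le_ceil _
  have hrle : ∀ᶠ N in atTop, (r N : ℝ) + 1 ≤ (1 + ε) * (α * k N) := by
    filter_upwards [(hkR.const_mul_atTop (mul_pos (half_pos hε) hα)).eventually_ge_atTop 2]
      with N hN
    have : (r N : ℝ) < (k N : ℝ) * ((1 + ε / 2) * α) + 1 := Nat.ceil_lt_add_one (by positivity)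
    linarith
  have hpos : ∀ N, 0 < α * (k N : ℝ) := fun N => mul_pos hα (by exact_mod_cast hk0 N)
  refine ⟨fun β hβ0 hβ1 => ?_, ?_⟩
  · obtain ⟨h, hch, hhe⟩ := exists_between hsh
    obtain ⟨h', hch', hh'⟩ := exists_between hch
    have hlog : ∀ᶠ N in atTop, Real.log (Fintype.card (G N)) ≤ k N * h' := by
      filter_upwards [hlim'.eventually_lt_const hch', hkR.eventually_gt_atTop 0] with N h1 h2
      rw [div_lt_iff₀ h2] at h1
      linarith
    refine tendsto_tupleProb_zero_of_eventually_imp (G := G)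
      (tendsto_tupleProb_card_ball_lt hs0 hs1 hsA hhe hh' (sub_pos.2 hβ1) hk hlog hmin' hrge) ?_
    filter_upwards [hrle, eventually_critical_mul_le_radius (G := G) hα ht0 ht1 hct hk0
      (w := fun N => β * Fintype.card (G N))
      (fun N => mul_pos hβ0 (by exact_mod_cast Fintype.card_pos (α := G N)))
      (tendsto_log_mul_card_div (G := G) hβ0 hk hlim') hε] with N h1 h2 z hz
    by_contra hcon
    rw [sub_sub_cancel, not_lt] at hcon
    obtain ⟨h3, h4⟩ := le_cayBallCard_typDist hcon
    have h3 : (typDist undir z β : ℝ) ≤ r N := by exact_mod_cast h3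
    exact absurd (abs_div_sub_one_le (hpos N) (h2 z _ h4) (by linarith)) (not_le.2 hz)
  · refine tendsto_tupleProb_zero_of_eventually_imp (G := G)
      (tendsto_tupleProb_not_reach hc hs0 hs1 hsA hsh hk hlim' hmin' hrge) ?_
    filter_upwards [hrle, hdiam G k hk0 hlim ε hε] with N h1 h2 z hz
    contrapose! hz
    obtain ⟨D, hD, hDr⟩ := exists_cayDiam_of_reach hz
    have hDr : (D : ℝ) ≤ r N + 1 := by exact_mod_cast hDr
    exact ⟨D, hD, abs_div_sub_one_le (hpos N) (h2 z D hD) (hDr.trans h1)⟩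

end LinearRegimeLimits

section SuperlinearRegime

variable {G : ℕ → Type} {k : ℕ → ℕ}

theorem typDistTargetLarge_eq {k n : ℕ} (hk : Real.log k ≠ 0)
    (hn : Real.log (Real.log n) ≠ 0) (hk0 : (k : ℝ) ≠ 0) (hn0 : Real.log n ≠ 0)
    (hkn : Real.log (k / Real.log n) ≠ 0) :
    typDistTargetLarge k n = Real.log n / Real.log (k / Real.log n) := by
  have h := Real.log_div hk0 hn0
  have h' : Real.log k - Real.log (Real.log n) ≠ 0 := by rwa [← h]
  rw [h, typDistTargetLarge]
  field_simp

theorem tendsto_log_card_of_superlinear [∀ N, Fintype (G N)]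
    (h1 : Tendsto (fun N => (k N : ℝ) / Real.log (Fintype.card (G N))) atTop atTop)
    (h2 : Tendsto (fun N => Real.log (k N) / Real.log (Fintype.card (G N))) atTop (nhds 0)) :
    Tendsto (fun N => Real.log (Fintype.card (G N))) atTop atTop := by
  have h3 : Tendsto (fun N => Real.log (k N / Real.log (Fintype.card (G N))) +
      Real.log (Real.log 2)) atTop atTop :=
    tendsto_atTop_add_const_right _ _ (Real.tendsto_log_atTop.comp h1)
  refine tendsto_atTop_mono' _ ?_ h3
  filter_upwards [h1.eventually_gt_atTop 0, h2.eventually_lt_const one_pos] with N h4 h5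
  have hl0 : 0 ≤ Real.log (Fintype.card (G N)) := Real.log_natCast_nonneg _
  have hlne : Real.log (Fintype.card (G N)) ≠ 0 := fun h => by simp [h] at h4
  have hl : 0 < Real.log (Fintype.card (G N)) := lt_of_le_of_ne hl0 hlne.symm
  have hk : (k N : ℝ) ≠ 0 := fun h => by simp [h] at h4
  rw [div_lt_one hl] at h5
  have h2n : 2 ≤ Fintype.card (G N) := by
    by_contra hlt
    have : Fintype.card (G N) = 0 ∨ Fintype.card (G N) = 1 := by omega
    rcases this with h | h <;> simp [h] at hlne
  have hlog2 : Real.log 2 ≤ Real.log (Fintype.card (G N)) :=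
    Real.log_le_log (by norm_num) (by exact_mod_cast h2n)
  have := Real.log_le_log (Real.log_pos one_lt_two) hlog2
  rw [Real.log_div hk hlne]
  linarith

theorem eventually_typDistTargetLarge_eq [∀ N, Fintype (G N)]
    (h1 : Tendsto (fun N => (k N : ℝ) / Real.log (Fintype.card (G N))) atTop atTop)
    (h2 : Tendsto (fun N => Real.log (k N) / Real.log (Fintype.card (G N))) atTop (nhds 0)) :
    (∀ᶠ N in atTop, typDistTargetLarge (k N) (Fintype.card (G N)) =
      Real.log (Fintype.card (G N)) / Real.log (k N / Real.log (Fintype.card (G N)))) ∧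
    Tendsto (fun N => typDistTargetLarge (k N) (Fintype.card (G N))) atTop atTop := by
  have hl := tendsto_log_card_of_superlinear h1 h2
  have hbasic : ∀ᶠ N in atTop, 1 < Real.log (Fintype.card (G N)) ∧
      1 < (k N : ℝ) / Real.log (Fintype.card (G N)) ∧
      Real.log (Fintype.card (G N)) < k N := by
    filter_upwards [hl.eventually_gt_atTop 1, h1.eventually_gt_atTop 1] with N h3 h4
    exact ⟨h3, h4, (one_lt_div (by linarith)).1 h4⟩
  have heq : ∀ᶠ N in atTop, typDistTargetLarge (k N) (Fintype.card (G N)) =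
      Real.log (Fintype.card (G N)) / Real.log (k N / Real.log (Fintype.card (G N))) := by
    filter_upwards [hbasic] with N h
    exact typDistTargetLarge_eq (Real.log_pos (h.1.trans h.2.2)).ne' (Real.log_pos h.1).ne'
      (by linarith [h.1, h.2.2]) (by linarith [h.1]) (Real.log_pos h.2.1).ne'
  refine ⟨heq, ?_⟩
  have hinv : Tendsto (fun N => (Real.log (k N) / Real.log (Fintype.card (G N)))⁻¹) atTop
      atTop := by
    refine Tendsto.inv_tendsto_nhdsGT_zero (tendsto_nhdsWithin_iff.2 ⟨h2, ?_⟩)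
    filter_upwards [hbasic] with N h
    exact div_pos (Real.log_pos (h.1.trans h.2.2)) (by linarith [h.1])
  refine tendsto_atTop_mono' _ ?_ hinv
  filter_upwards [hbasic, heq] with N h h'
  have hl0 : 0 < Real.log (Fintype.card (G N)) := by linarith [h.1]
  rw [h', inv_div]
  refine div_le_div_of_nonneg_left hl0.le (Real.log_pos h.2.1)
    (Real.log_le_log (by linarith [h.2.1]) ?_)
  exact div_le_self (Nat.cast_nonneg _) h.1.le

theorem eventually_typDistTargetLarge_le_diam [∀ N, CommGroup (G N)] [∀ N, Fintype (G N)]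
    (undir : Bool)
    (h1 : Tendsto (fun N => (k N : ℝ) / Real.log (Fintype.card (G N))) atTop atTop)
    (h2 : Tendsto (fun N => Real.log (k N) / Real.log (Fintype.card (G N))) atTop (nhds 0))
    {ε : ℝ} (hε : 0 < ε) :
    ∀ᶠ N in atTop, ∀ (z : Fin (k N) → G N) (D : ℕ), cayDiam undir z = (D : ℕ∞) →
      (1 - ε) * typDistTargetLarge (k N) (Fintype.card (G N)) ≤ (D : ℝ) := by
  obtain ⟨heq, htop⟩ := eventually_typDistTargetLarge_eq h1 h2
  rcases le_or_gt 1 ε with hε1 | hε1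
  · filter_upwards [htop.eventually_ge_atTop 0] with N hN z D _
    exact (mul_nonpos_of_nonpos_of_nonneg (by linarith) hN).trans (Nat.cast_nonneg D)
  set η : ℝ := ε / 8 with hη
  have hη0 : 0 < η := by positivity
  have hlw := Real.tendsto_log_atTop.comp h1
  filter_upwards [heq, (tendsto_log_card_of_superlinear h1 h2).eventually_gt_atTop 0,
    h1.eventually_ge_atTop 1, hlw.eventually_gt_atTop 0,
    (hlw.const_mul_atTop hη0).eventually_ge_atTop (Real.log η⁻¹)] with N h3 h4 h5 h6 h7 z D hD
  simp only [Function.comp_apply] at h6 h7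
  set ℓ := Real.log (Fintype.card (G N)) with hℓ
  set ω := (k N : ℝ) / ℓ with hω
  have hω0 : 0 < ω := by linarith
  set t := η / ω with ht
  have ht0 : 0 < t := by positivity
  have ht1 : t ≤ 1 / 8 := by
    rw [ht, div_le_iff₀ hω0]
    linarith
  have hlogGF : Real.log (letterGF undir t) ≤ 4 * t := by
    have hGF1 := one_le_letterGF (undir := undir) ht0.le (by linarith)
    refine (Real.log_le_sub_one_of_pos (by linarith)).trans ?_
    have h8 := letterGF_le (undir := undir) ht0.le (show t < 1 by linarith)
    have h9 : (1 + t) / (1 - t) ≤ 1 + 4 * t := by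
      rw [div_le_iff₀ (by linarith)]
      nlinarith
    linarith
  have hvol := log_cayBallCard_le (undir := undir) z ht0 (by linarith) D
    (c := Fintype.card (G N)) (by exact_mod_cast Fintype.card_pos)
    (by rw [cayBallCard_of_cayDiam_eq hD])
  rw [← hℓ] at hvol
  have hkt : (k N : ℝ) * t = η * ℓ := by
    have hk : (k N : ℝ) ≠ 0 := fun h => by simp [hω, h] at hω0
    rw [ht, hω]
    field_simp
  have hlt : Real.log t⁻¹ = Real.log ω + Real.log η⁻¹ := by
    rw [ht, inv_div, Real.log_div hω0.ne' hη0.ne', Real.log_inv]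
    ring
  have h8 : (k N : ℝ) * Real.log (letterGF undir t) ≤ k N * (4 * t) := by gcongr
  have h9 : (D : ℝ) * Real.log t⁻¹ ≤ D * ((1 + η) * Real.log ω) := by
    rw [hlt]
    gcongr
    linarith
  have h10 : (1 - 4 * η) * ℓ ≤ (1 + η) * (D * Real.log ω) := by linarith
  have h11 : (1 - ε) * (1 + η) ≤ 1 - 4 * η := by
    rw [hη]
    nlinarith
  have h12 : (1 + η) * ((1 - ε) * ℓ) ≤ (1 + η) * (D * Real.log ω) := by nlinarith
  rw [h3, ← mul_div_assoc, div_le_iff₀ h6]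
  exact le_of_mul_le_mul_left h12 (by linarith)

theorem tendsto_tupleProb_not_reach_superlinear [∀ N, Group (G N)] [∀ N, Fintype (G N)]
    (undir : Bool)
    (h1 : Tendsto (fun N => (k N : ℝ) / Real.log (Fintype.card (G N))) atTop atTop)
    (h2 : Tendsto (fun N => Real.log (k N) / Real.log (Fintype.card (G N))) atTop (nhds 0))
    {ε : ℝ} (hε : 0 < ε) :
    Tendsto (fun N => tupleProb (G N) (k N) fun z => ¬ ∀ x, Reach undir z
      (⌈(1 + ε) * typDistTargetLarge (k N) (Fintype.card (G N))⌉₊ + 1) x) atTop (nhds 0) := by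
  obtain ⟨heq, htop⟩ := eventually_typDistTargetLarge_eq h1 h2
  have hl := tendsto_log_card_of_superlinear h1 h2
  have hlw := Real.tendsto_log_atTop.comp h1
  have hlog2 := Real.log_pos one_lt_two
  have hlim : Tendsto (fun N => Real.exp (-(ε * Real.log (Fintype.card (G N)))) / (1 / 2) +
      Real.exp (-Real.log (Fintype.card (G N)))) atTop (nhds 0) := by
    simpa using ((Real.tendsto_exp_neg_atTop_nhds_zero.comp (hl.const_mul_atTop hε)).div_const
      (1 / 2)).add (Real.tendsto_exp_neg_atTop_nhds_zero.comp hl)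
  refine squeeze_zero' (Eventually.of_forall fun N => tupleProb_nonneg _) ?_ hlim
  filter_upwards [heq, htop.eventually_ge_atTop 1, hl.eventually_gt_atTop 1,
    h1.eventually_ge_atTop 2, h1.eventually_ge_atTop (4 / Real.log 2),
    hlw.eventually_ge_atTop (8 * (2 + ε))] with N h3 h4 h5 h6 h7 h8
  simp only [Function.comp_apply] at h8
  set T := typDistTargetLarge (k N) (Fintype.card (G N)) with hT
  have hn : (0 : ℝ) < Fintype.card (G N) := by exact_mod_cast Fintype.card_pos
  have hnexp := Real.exp_log hn
  set ℓ := Real.log (Fintype.card (G N)) with hℓ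
  set ω := (k N : ℝ) / ℓ with hω
  set L := ⌈(1 + ε) * T⌉₊ with hL
  have hω0 : 0 < ω := by linarith
  have hlω : 0 < Real.log ω := by linarith
  have hk : (k N : ℝ) = ω * ℓ := by
    rw [hω, div_mul_cancel₀ _ (by linarith)]
  have hTl : T * Real.log ω = ℓ := by rw [h3, div_mul_cancel₀ _ hlω.ne']
  have hLge : (1 + ε) * T ≤ L := Nat.le_ceil _
  have hLle : (L : ℝ) ≤ (2 + ε) * T := by
    have : (L : ℝ) < (1 + ε) * T + 1 := Nat.ceil_lt_add_one (by positivity)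
    linarith
  have hL0 : (0 : ℝ) < L := lt_of_lt_of_le (by positivity) hLge
  set a := k N / 2 with ha
  set b := k N - a with hb
  have hab : k N = a + b := by omega
  have hbge : (k N : ℝ) / 2 ≤ b := by
    have : k N ≤ 2 * b := by omega
    have : (k N : ℝ) ≤ 2 * b := by exact_mod_cast this
    linarith
  have hage : (k N : ℝ) / 2 - 1 / 2 ≤ a := by
    have : k N ≤ 2 * a + 1 := by omega
    have : (k N : ℝ) ≤ 2 * a + 1 := by exact_mod_cast this
    linarith
  have hk2 : (2 : ℝ) ≤ k N := by rw [hk]; nlinarith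
  have hBω : ω ≤ (a / L : ℕ) := by
    have h9 : 2 * ω * L ≤ a := by
      have h10 : 2 * ω * L ≤ 2 * ω * ((2 + ε) * T) := by gcongr
      have h11 : 8 * (2 + ε) * (ω * T) ≤ Real.log ω * (ω * T) := by gcongr
      have h12 : Real.log ω * (ω * T) = k N := by rw [hk, ← hTl]; ring
      nlinarith
    have h10 : (a : ℝ) < L * ((a / L : ℕ) + 1) := by
      have : 0 < L := by exact_mod_cast hL0
      exact_mod_cast Nat.lt_mul_div_succ a this
    have h11 : 2 * ω < (a / L : ℕ) + 1 := by
      refine lt_of_mul_lt_mul_left (lt_of_le_of_lt (le_of_eq ?_) (h9.trans_lt h10)) hL0.le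
      ring
    linarith
  have hB0 : 0 < a / L := by
    have : (0 : ℝ) < (a / L : ℕ) := hω0.trans_le hBω
    exact_mod_cast this
  refine (tupleProb_not_reach_le undir hab L (δ := 1 / 2) (by norm_num)).trans ?_
  refine add_le_add ((tupleProb_card_ball_lt_of_blocks (Nat.mul_div_le a L) hB0 (by norm_num)
    undir).trans ?_) ?_
  · gcongr
    have h9 : Real.exp ((1 + ε) * ℓ) ≤ ((a / L : ℕ) : ℝ) ^ L := by
      calc Real.exp ((1 + ε) * ℓ) ≤ Real.exp (L * Real.log ω) := by
            rw [Real.exp_le_exp, ← hTl, ← mul_assoc]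
            gcongr
        _ = ω ^ L := by rw [Real.exp_nat_mul, Real.exp_log hω0]
        _ ≤ _ := by gcongr
    rw [div_le_iff₀ (lt_of_lt_of_le (Real.exp_pos _) h9)]
    calc (Fintype.card (G N) : ℝ) = Real.exp (-(ε * ℓ)) * Real.exp ((1 + ε) * ℓ) := by
          rw [← Real.exp_add, ← hnexp]
          congr 1
          ring
      _ ≤ _ := by gcongr
  · have h9 : (1 / 2 : ℝ) ^ b = Real.exp (-(b * Real.log 2)) := by
      rw [← mul_neg, Real.exp_nat_mul, ← Real.log_inv, Real.exp_log (by norm_num)]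
      norm_num
    rw [h9, ← hnexp, ← Real.exp_add, Real.exp_le_exp]
    rw [div_le_iff₀ hlog2] at h7
    have h10 : (k N : ℝ) / 2 * Real.log 2 ≤ b * Real.log 2 := by gcongr
    have h11 : 4 * ℓ ≤ ω * Real.log 2 * ℓ := by gcongr
    rw [hk] at h10
    linarith

theorem tendsto_tupleProb_not_diam_le [∀ N, Group (G N)] [∀ N, Fintype (G N)] (undir : Bool)
    (h1 : Tendsto (fun N => (k N : ℝ) / Real.log (Fintype.card (G N))) atTop atTop)
    (h2 : Tendsto (fun N => Real.log (k N) / Real.log (Fintype.card (G N))) atTop (nhds 0))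
    {ε : ℝ} (hε : 0 < ε) :
    Tendsto (fun N => tupleProb (G N) (k N) fun z => ¬ ∃ D : ℕ, cayDiam undir z = (D : ℕ∞) ∧
      (D : ℝ) ≤ (1 + ε) * typDistTargetLarge (k N) (Fintype.card (G N))) atTop (nhds 0) := by
  refine tendsto_tupleProb_zero_of_eventually_imp (G := G)
    (tendsto_tupleProb_not_reach_superlinear undir h1 h2 (half_pos hε)) ?_
  obtain ⟨-, htop⟩ := eventually_typDistTargetLarge_eq h1 h2
  filter_upwards [htop.eventually_ge_atTop 0,
    (htop.const_mul_atTop (half_pos hε)).eventually_ge_atTop 2] with N h3 h4 z hz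
  contrapose! hz
  obtain ⟨D, hD, hDr⟩ := exists_cayDiam_of_reach hz
  refine ⟨D, hD, ?_⟩
  have hDr : (D : ℝ) ≤ ⌈(1 + ε / 2) * typDistTargetLarge (k N) (Fintype.card (G N))⌉₊ + 1 := by
    exact_mod_cast hDr
  have := Nat.ceil_lt_add_one
    (show 0 ≤ (1 + ε / 2) * typDistTargetLarge (k N) (Fintype.card (G N)) by positivity)
  linarith

end SuperlinearRegime

end RandomCayleyGraphs

theorem statement4 :
    -- (i) regime k ≍ log |G|
    (∀ lambda : ℝ, 0 < lambda →
    ∃ α : Bool → ℝ, (∀ undir, 0 < α undir) ∧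
    ((∀ (G : ℕ → Type) [∀ N, CommGroup (G N)] [∀ N, Fintype (G N)] (k : ℕ → ℕ),
      (∀ N, 0 < k N) →
      Tendsto k atTop atTop →
      Tendsto (fun N => (k N : ℝ) / Real.log (Fintype.card (G N))) atTop (nhds lambda) →
      Tendsto (fun N => mStar (G N)) atTop atTop →
      (∀ N, (minGen (G N) : ℝ) ≤
        (1 / 4) * Real.log (Fintype.card (G N)) / Real.log (Real.log (Fintype.card (G N)))) →
      ∀ undir : Bool, ∀ ε : ℝ, 0 < ε →
        (∀ β : ℝ, 0 < β → β < 1 →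
          Tendsto (fun N => tupleProb (G N) (k N) fun z =>
              ε < |(typDist undir z β : ℝ) / (α undir * (k N : ℝ)) - 1|)
            atTop (nhds 0)) ∧
        Tendsto (fun N => tupleProb (G N) (k N) fun z =>
            ¬ ∃ D : ℕ, cayDiam undir z = (D : ℕ∞) ∧
              |(D : ℝ) / (α undir * (k N : ℝ)) - 1| ≤ ε)
          atTop (nhds 0)) ∧
    -- (i) deterministic lower bound for the diameter, all Abelian groups
    (∀ (G : ℕ → Type) [∀ N, CommGroup (G N)] [∀ N, Fintype (G N)] (k : ℕ → ℕ),
      (∀ N, 0 < k N) →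
      Tendsto (fun N => (k N : ℝ) / Real.log (Fintype.card (G N))) atTop (nhds lambda) →
      ∀ undir : Bool, ∀ ε : ℝ, 0 < ε →
        ∀ z : (N : ℕ) → Fin (k N) → G N,
        ∀ᶠ N in atTop, ∀ D : ℕ, cayDiam undir (z N) = (D : ℕ∞) →
          (1 - ε) * (α undir * (k N : ℝ)) ≤ (D : ℝ)))) ∧
    -- (ii) regime k ≫ log |G|
    ((∀ (G : ℕ → Type) [∀ N, CommGroup (G N)] [∀ N, Fintype (G N)] (k : ℕ → ℕ),
      (∀ N, 0 < k N) →
      Tendsto (fun N => (k N : ℝ) / Real.log (Fintype.card (G N))) atTop atTop →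
      Tendsto (fun N => Real.log (k N) / Real.log (Fintype.card (G N))) atTop (nhds 0) →
      ∀ undir : Bool, ∀ ε : ℝ, 0 < ε →
        Tendsto (fun N => tupleProb (G N) (k N) fun z =>
            ¬ ∃ D : ℕ, cayDiam undir z = (D : ℕ∞) ∧
              |(D : ℝ) / typDistTargetLarge (k N) (Fintype.card (G N)) - 1| ≤ ε)
          atTop (nhds 0)) ∧
    -- (ii) deterministic lower bound, all Abelian groups
    (∀ (G : ℕ → Type) [∀ N, CommGroup (G N)] [∀ N, Fintype (G N)] (k : ℕ → ℕ),
      (∀ N, 0 < k N) →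
      Tendsto (fun N => (k N : ℝ) / Real.log (Fintype.card (G N))) atTop atTop →
      Tendsto (fun N => Real.log (k N) / Real.log (Fintype.card (G N))) atTop (nhds 0) →
      ∀ undir : Bool, ∀ ε : ℝ, 0 < ε →
        ∀ z : (N : ℕ) → Fin (k N) → G N,
        ∀ᶠ N in atTop, ∀ D : ℕ, cayDiam undir (z N) = (D : ℕ∞) →
          (1 - ε) * typDistTargetLarge (k N) (Fintype.card (G N)) ≤ (D : ℝ)) ∧
    -- (ii) upper bound for arbitrary finite groups
    (∀ (G : ℕ → Type) [∀ N, Group (G N)] [∀ N, Fintype (G N)] (k : ℕ → ℕ),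
      (∀ N, 0 < k N) →
      Tendsto (fun N => (k N : ℝ) / Real.log (Fintype.card (G N))) atTop atTop →
      Tendsto (fun N => Real.log (k N) / Real.log (Fintype.card (G N))) atTop (nhds 0) →
      ∀ undir : Bool, ∀ ε : ℝ, 0 < ε →
        Tendsto (fun N => tupleProb (G N) (k N) fun z =>
            ∃ D : ℕ, cayDiam undir z = (D : ℕ∞) ∧
              (D : ℝ) ≤ (1 + ε) * typDistTargetLarge (k N) (Fintype.card (G N)))
          atTop (nhds 1))) := by
  refine ⟨fun lambda hl => ?_, ?_, ?_, ?_⟩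
  · choose α hα hprob hdiam using exists_linear_regime_constant hl
    exact ⟨α, hα, fun G _ _ k hk0 hk hlim _ hmin undir ε hε =>
        hprob undir G k hk0 hk hlim hmin ε hε,
      fun G _ _ k hk0 hlim undir ε hε z =>
        (hdiam undir G k hk0 hlim ε hε).mono fun N hN => hN (z N)⟩
  · intro G _ _ k _ h1 h2 undir ε hε
    refine tendsto_tupleProb_zero_of_eventually_imp (G := G)
      (tendsto_tupleProb_not_diam_le undir h1 h2 hε) ?_
    filter_upwards [eventually_typDistTargetLarge_le_diam undir h1 h2 hε,
      (eventually_typDistTargetLarge_eq h1 h2).2.eventually_gt_atTop 0] with N h3 h4 z hz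
    contrapose! hz
    obtain ⟨D, hD, hle⟩ := hz
    exact ⟨D, hD, abs_div_sub_one_le h4 (h3 z D hD) hle⟩
  · intro G _ _ k _ h1 h2 undir ε hε z
    exact (eventually_typDistTargetLarge_le_diam undir h1 h2 hε).mono fun N hN => hN (z N)
  · intro G _ _ k _ h1 h2 undir ε hε
    have h := (tendsto_const_nhds (x := (1 : ℝ))).sub
      (tendsto_tupleProb_not_diam_le (G := G) undir h1 h2 hε)
    rw [sub_zero] at h
    refine h.congr fun N => ?_
    rw [tupleProb_not, sub_sub_cancel]
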